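/- arXiv:2109.05514 — 2 statements merged into one kernel-verified Lean document; each statement's English description precedes it below -/
import Mathlib

section
/- (Theorem 3(i), classification) Up to equivalence, there are exactly two Hadamard matrices of order 36 all of whose rows, reduced modulo 3 (reading −1 as 2), are codewords of L(17): there exist Hadamard matrices M₁, M₂ of order 36 with all rows (mod 3) in L(17) that are not equivalent to each other, and every Hadamard matrix of order 36 with all rows (mod 3) in L(17) is equivalent to M₁ or to M₂. One class is represented by the Paley-type matrix H = [[I_{18} − U_{17}ᵀ, U_{17} + I_{18}], [I_{18} + U_{17}ᵀ, U_{17} − I_{18}]]. -/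
open Matrix Finset

/-- The Pless matrix `S_q`, with rows and columns indexed by `GF(q) ∪ {∞}`
(`none` playing the role of `∞`), built from the quadratic character of `GF(q)`. -/
def Smat (F : Type) [Field F] [Fintype F] [DecidableEq F] :
    Matrix (Option F) (Option F) ℤ := fun i j =>
  match i, j with
  | none, none => 0
  | none, some _ => 1
  | some _, none => quadraticChar F (-1)
  | some a, some b => quadraticChar F (a - b)

/-- The matrix `U_q`, obtained from `S_q` by replacing each entry `s_{a,∞}`
(`a ∈ GF(q)`) in the column labeled `∞` by `-1`. -/
def Umat (F : Type) [Field F] [Fintype F] [DecidableEq F] :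
    Matrix (Option F) (Option F) ℤ := fun i j =>
  match i, j with
  | some _, none => -1
  | i, j => Smat F i j

/-- The row of the generator matrix `(I | U_q)` of the code `L(q)`,
reduced modulo 3, indexed by `i : Option F`. -/
def genRowL (F : Type) [Field F] [Fintype F] [DecidableEq F] (i : Option F) :
    (Option F ⊕ Option F) → ZMod 3 := fun j =>
  match j with
  | Sum.inl k => if i = k then 1 else 0
  | Sum.inr k => ((Umat F i k : ℤ) : ZMod 3)

/-- The code `L(q)`: the ternary code of length `2q+2` spanned by the rows of
`(I | U_q)` reduced modulo 3; it is monomially equivalent to the Pless symmetry code. -/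
def Lcode (F : Type) [Field F] [Fintype F] [DecidableEq F] :
    Submodule (ZMod 3) ((Option F ⊕ Option F) → ZMod 3) :=
  Submodule.span (ZMod 3) (Set.range (genRowL F))

/-- The Hadamard matrix `H = [[I − U_qᵀ, U_q + I], [I + U_qᵀ, U_q − I]]`. -/
def Hmat (F : Type) [Field F] [Fintype F] [DecidableEq F] :
    Matrix (Option F ⊕ Option F) (Option F ⊕ Option F) ℤ :=
  Matrix.fromBlocks (1 - (Umat F)ᵀ) (Umat F + 1) (1 + (Umat F)ᵀ) (Umat F - 1)

instance : Fact (Nat.Prime 17) := ⟨by norm_num⟩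

/-- The 36-element coordinate index set of `L(17)`. -/
abbrev idx := Option (ZMod 17) ⊕ Option (ZMod 17)

/-- A Hadamard matrix of order 36: a ±1 integer matrix `M` with `M Mᵀ = 36 I`. -/
def IsHadamard36 (M : Matrix idx idx ℤ) : Prop :=
  (∀ i j, M i j = 1 ∨ M i j = -1) ∧ M * Mᵀ = (36 : ℤ) • (1 : Matrix idx idx ℤ)

/-- A monomial `{0, ±1}` integer matrix: every entry is `0`, `1` or `-1`, and every row
and every column contains exactly one nonzero entry. -/
def IsMonomialZ (M : Matrix idx idx ℤ) : Prop :=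
  (∀ i j, M i j = 0 ∨ M i j = 1 ∨ M i j = -1) ∧
  (∀ i, ∃! j, M i j ≠ 0) ∧ (∀ j, ∃! i, M i j ≠ 0)

/-- Equivalence of Hadamard matrices: `M` and `N` are equivalent if `L M R = N` for some
monomial `{0, ±1}` matrices `L`, `R`. -/
def HadEquiv (M N : Matrix idx idx ℤ) : Prop :=
  ∃ L R : Matrix idx idx ℤ, IsMonomialZ L ∧ IsMonomialZ R ∧ L * M * R = N

namespace PlessCode

/-- The position `0, …, 35` of a coordinate of `L(17)`. -/
def pos : idx → ℕ
  | Sum.inl none => 0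
  | Sum.inl (some a) => a.val + 1
  | Sum.inr none => 18
  | Sum.inr (some a) => a.val + 19

/-- The coordinate of `L(17)` at a given position. -/
def unpos (n : ℕ) : idx :=
  if n = 0 then Sum.inl none else if n < 18 then Sum.inl (some ((n - 1 : ℕ) : ZMod 17))
  else if n = 18 then Sum.inr none else Sum.inr (some ((n - 19 : ℕ) : ZMod 17))

lemma unpos_pos : ∀ i, unpos (pos i) = i := by decide +kernel

lemma pos_unpos : ∀ n < 36, pos (unpos n) = n := by decide +kernel

lemma pos_lt : ∀ i, pos i < 36 := by decide +kernel

lemma pos_injective : Function.Injective pos := Function.LeftInverse.injective unpos_pos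

lemma sum_pos {R : Type} [AddCommMonoid R] (f : ℕ → R) :
    ∑ i : idx, f (pos i) = ∑ n ∈ range 36, f n := by
  refine Finset.sum_bij' (fun i _ => pos i) (fun n _ => unpos n) ?_ ?_ ?_ ?_ ?_
  · intro i _
    simpa using pos_lt i
  · intros
    simp
  · intro i _
    exact unpos_pos i
  · intro n hn
    exact pos_unpos n (by simpa using hn)
  · intros
    rfl

lemma pos_inl_lt : ∀ i, pos (Sum.inl i) < 18 := by decide +kernel

lemma pos_inr : ∀ i, pos (Sum.inr i) = pos (Sum.inl i) + 18 := by decide +kernel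

lemma unpos_inl : ∀ n < 18, ∃ i, unpos n = Sum.inl i := by decide +kernel

lemma sum_pos_inl {R : Type} [AddCommMonoid R] (f : ℕ → R) :
    ∑ i : Option (ZMod 17), f (pos (Sum.inl i)) = ∑ n ∈ range 18, f n := by
  refine Finset.sum_nbij (fun i => pos (Sum.inl i)) ?_ ?_ ?_ ?_
  · intro i _
    simpa using pos_inl_lt i
  · intro i _ j _ h
    exact Sum.inl_injective (pos_injective h)
  · intro n hn
    have hn : n < 18 := by simpa using hn
    obtain ⟨i, hi⟩ := unpos_inl n hn
    exact ⟨i, by simp, by simp [← hi, pos_unpos n (by omega)]⟩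
  · intros
    rfl

/-- The sign `(-1) ^ b`, where `b` is the bit of `x` at position `j`. -/
def sg (x j : ℕ) : ℤ := if x.testBit j then -1 else 1

lemma sg_eq_or (x j : ℕ) : sg x j = 1 ∨ sg x j = -1 := by
  unfold sg
  split_ifs <;> simp

/-- The `±1` vector whose signs are given by the bits of `x`. -/
def vec (x : ℕ) : idx → ℤ := fun j => sg x (pos j)

lemma exists_vec (f : idx → ℤ) (hf : ∀ j, f j = 1 ∨ f j = -1) : ∃ x < 2 ^ 36, f = vec x := by
  refine ⟨Nat.ofBits fun i : Fin 36 => decide (f (unpos i) = -1), Nat.ofBits_lt_two_pow _, ?_⟩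
  funext j
  unfold vec sg
  rw [Nat.testBit_ofBits_lt _ _ (pos_lt j)]
  simp only [unpos_pos]
  rcases hf j with h | h <;> simp [h]

/-- Complementing all 36 bits. -/
def compl36 (x : ℕ) : ℕ := 2 ^ 36 - 1 - x

lemma sg_compl {x : ℕ} (hx : x < 2 ^ 36) {j : ℕ} (hj : j < 36) : sg (compl36 x) j = - sg x j := by
  unfold sg compl36
  have : 2 ^ 36 - 1 - x = 2 ^ 36 - (x + 1) := by omega
  rw [this, Nat.testBit_two_pow_sub_succ hx]
  by_cases h : x.testBit j <;> simp [h, hj]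

lemma vec_compl {x : ℕ} (hx : x < 2 ^ 36) : vec (compl36 x) = - vec x := by
  funext j
  exact sg_compl hx (pos_lt j)

/-- Reduction modulo 3 of an integer vector. -/
def red (f : idx → ℤ) : idx → ZMod 3 := fun j => (f j : ZMod 3)

lemma red_neg (f : idx → ℤ) : red (-f) = - red f := by
  funext j
  simp [red]

lemma mem_Lcode_iff (f : idx → ZMod 3) : f ∈ Lcode (ZMod 17) ↔
    ∀ k, f (Sum.inr k) = ∑ i, f (Sum.inl i) * ((Umat (ZMod 17) i k : ℤ) : ZMod 3) := by
  rw [Lcode, Submodule.mem_span_range_iff_exists_fun]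
  constructor
  · rintro ⟨c, rfl⟩ k
    have h : ∀ k, (∑ i, c i • genRowL (ZMod 17) i) (Sum.inl k) = c k := by
      intro k
      simp [Finset.sum_apply, genRowL]
    simp only [h]
    simp [Finset.sum_apply, genRowL]
  · intro h
    refine ⟨fun i => f (Sum.inl i), ?_⟩
    funext j
    rcases j with j | j
    · simp [Finset.sum_apply, genRowL]
    · rw [h j]
      simp [Finset.sum_apply, genRowL]

/-- The entries of `U₁₇` modulo 3, by position. -/
def ut (i c : ℕ) : ℕ :=
  if i = 0 then (if c = 0 then 0 else 1) else if c = 0 then 2 else if i = c then 0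
  else if Nat.testBit 107286 ((i + 17 - c) % 17) then 1 else 2

lemma Umat_eq : ∀ i k, ((Umat (ZMod 17) i k : ℤ) : ZMod 3) =
    (ut (pos (Sum.inl i)) (pos (Sum.inl k)) : ZMod 3) := by
  decide +kernel

lemma red_vec_mem_iff (x : ℕ) : red (vec x) ∈ Lcode (ZMod 17) ↔
    ∀ c < 18, (sg x (c + 18) : ZMod 3) = ∑ i ∈ range 18, (sg x i : ZMod 3) * (ut i c : ZMod 3) := by
  rw [mem_Lcode_iff]
  simp only [red, vec, Umat_eq, pos_inr]
  have h (k : Option (ZMod 17)) := sum_pos_inl fun n =>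
    (sg x n : ZMod 3) * (ut n (pos (Sum.inl k)) : ZMod 3)
  simp only [h]
  constructor
  · intro H c hc
    obtain ⟨i, hi⟩ := unpos_inl c hc
    have := H i
    rwa [← hi, pos_unpos c (by omega)] at this
  · intro H k
    exact H _ (pos_inl_lt k)

/-- `force n f = f n`, with `n` evaluated first by the kernel. -/
def force {α : Type} (n : ℕ) (f : ℕ → α) : α :=
  match n with
  | 0 => f 0
  | k + 1 => f (k + 1)

@[simp] lemma force_eq {α : Type} (n : ℕ) (f : ℕ → α) : force n f = f n := by
  cases n <;> rfl

/-- Concatenate three pairs of truth tables, the first of each pair having length `s`. -/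
def glue (s a b c a' b' c' : ℕ) (k : ℕ → ℕ → ℕ → ℕ) : ℕ :=
  force (a ||| a' <<< s) fun a => force (b ||| b' <<< s) fun b => force (c ||| c' <<< s) fun c =>
    k a b c

/-- Truth tables, over `x < 2 ^ n`, of the three possible values modulo 3 of
`∑ i < n, sg x i * u i`. -/
def slice (u : ℕ → ℕ) : ℕ → (ℕ → ℕ → ℕ → ℕ) → ℕ
  | 0, k => k 1 0 0
  | n + 1, k => slice u n fun a b c =>
    match u n with
    | 0 => glue (2 ^ n) a b c a b c k
    | 1 => glue (2 ^ n) c a b b c a k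
    | _ => glue (2 ^ n) b c a c a b k

/-- `a` is the truth table of `∑ i < n, sg x i * u i = r` over `x < 2 ^ n`. -/
def IsTable (u : ℕ → ℕ) (n : ℕ) (r : ZMod 3) (a : ℕ) : Prop :=
  ∀ x, a.testBit x = true ↔ x < 2 ^ n ∧ ∑ i ∈ range n, (sg x i : ZMod 3) * (u i : ZMod 3) = r

lemma IsTable.glue {u : ℕ → ℕ} {n : ℕ} {r r₁ r₂ : ZMod 3} {a b : ℕ} (ha : IsTable u n r₁ a)
    (hb : IsTable u n r₂ b) (h₁ : r₁ + u n = r) (h₂ : r₂ - u n = r) :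
    IsTable u (n + 1) r (a ||| b <<< 2 ^ n) := by
  intro x
  rw [Nat.testBit_or, Nat.testBit_shiftLeft, Finset.sum_range_succ]
  rcases lt_or_ge x (2 ^ n) with hx | hx
  · have h : sg x n = 1 := by simp [sg, Nat.testBit_lt_two_pow hx]
    have hx' : x < 2 ^ (n + 1) := by
      rw [pow_succ]
      omega
    simp only [h, show ¬ (x ≥ 2 ^ n) by omega, decide_false, Bool.false_and, Bool.or_false, ha x, hx,
      hx', true_and]
    subst h₁
    simp
  · obtain ⟨y, rfl⟩ := Nat.exists_eq_add_of_le hx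
    have h : ∀ i < n, sg (2 ^ n + y) i = sg y i := by
      intro i hi
      simp [sg, Nat.testBit_two_pow_add_gt hi]
    have hs : ∑ i ∈ range n, (sg (2 ^ n + y) i : ZMod 3) * (u i : ZMod 3) =
        ∑ i ∈ range n, (sg y i : ZMod 3) * (u i : ZMod 3) :=
      Finset.sum_congr rfl fun i hi => by rw [h i (by simpa using hi)]
    have ha' : a.testBit (2 ^ n + y) = false := by
      rw [← Bool.not_eq_true, ha]
      omega
    rw [ha', hs]
    simp only [hx, decide_true, Bool.true_and, Bool.false_or, Nat.add_sub_cancel_left, hb y]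
    have hlt : 2 ^ n + y < 2 ^ (n + 1) ↔ y < 2 ^ n := by
      rw [pow_succ]
      omega
    rw [hlt]
    refine and_congr_right fun hy => ?_
    have : sg (2 ^ n + y) n = -1 := by
      simp [sg, Nat.testBit_two_pow_add_eq, Nat.testBit_lt_two_pow hy]
    subst h₂
    rw [this]
    push_cast
    rw [neg_one_mul, ← sub_eq_add_neg, sub_left_inj]

lemma slice_spec (u : ℕ → ℕ) (hu : ∀ i, u i ≤ 2) (n : ℕ) : ∀ k, ∃ a b c, IsTable u n 0 a ∧
    IsTable u n 1 b ∧ IsTable u n 2 c ∧ slice u n k = k a b c := by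
  induction n with
  | zero =>
    intro k
    refine ⟨1, 0, 0, ?_, ?_, ?_, rfl⟩ <;> intro x
    · simp [Nat.testBit_one_eq_true_iff_self_eq_zero]
    · simp
    · simpa using fun _ => (by decide : (0 : ZMod 3) ≠ 2)
  | succ n ih =>
    intro k
    obtain ⟨a, b, c, ha, hb, hc, h⟩ := ih fun a b c =>
      match u n with
      | 0 => glue (2 ^ n) a b c a b c k
      | 1 => glue (2 ^ n) c a b b c a k
      | _ => glue (2 ^ n) b c a c a b k
    rw [slice, h]
    have hun := hu n
    generalize hv : u n = v at hun ⊢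
    interval_cases v
    · exact ⟨_, _, _, ha.glue ha (by rw [hv]; rfl) (by rw [hv]; rfl),
        hb.glue hb (by rw [hv]; rfl) (by rw [hv]; rfl),
        hc.glue hc (by rw [hv]; rfl) (by rw [hv]; rfl), by simp [PlessCode.glue]⟩
    · exact ⟨_, _, _, hc.glue hb (by rw [hv]; rfl) (by rw [hv]; rfl),
        ha.glue hc (by rw [hv]; rfl) (by rw [hv]; rfl),
        hb.glue ha (by rw [hv]; rfl) (by rw [hv]; rfl), by simp [PlessCode.glue]⟩
    · exact ⟨_, _, _, hb.glue hc (by rw [hv]; rfl) (by rw [hv]; rfl),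
        hc.glue ha (by rw [hv]; rfl) (by rw [hv]; rfl),
        ha.glue hb (by rw [hv]; rfl) (by rw [hv]; rfl), by simp [PlessCode.glue]⟩

/-- Table of the `x < 2 ^ 18` for which none of the first `n` check symbols vanishes. -/
def fullTable : ℕ → ℕ
  | 0 => 2 ^ (2 ^ 18) - 1
  | n + 1 => fullTable n &&& slice (fun i => ut i n) 18 fun _ b c => b ||| c

lemma ut_le (i c : ℕ) : ut i c ≤ 2 := by
  unfold ut
  split_ifs <;> simp

lemma testBit_fullTable {x : ℕ} (hx : x < 2 ^ 18) (n : ℕ)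
    (h : ∀ c < n, ∑ i ∈ range 18, (sg x i : ZMod 3) * (ut i c : ZMod 3) ≠ 0) :
    (fullTable n).testBit x = true := by
  induction n with
  | zero =>
    rw [fullTable, Nat.testBit_two_pow_sub_one]
    simpa using hx
  | succ n ih =>
    obtain ⟨a, b, c, -, hb, hc, e⟩ := slice_spec (fun i => ut i n) (fun i => ut_le i n) 18
      fun _ b c => b ||| c
    rw [fullTable, e, Nat.testBit_and, ih fun c hc => h c (by omega), Nat.testBit_or,
      Bool.true_and, Bool.or_eq_true, hb, hc]
    have h0 := h n (by omega)
    generalize ∑ i ∈ range 18, (sg x i : ZMod 3) * (ut i n : ZMod 3) = r at h0 ⊢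
    have : ∀ r : ZMod 3, r ≠ 0 → r = 1 ∨ r = 2 := by decide
    rcases this r h0 with h | h
    · exact Or.inl ⟨hx, h⟩
    · exact Or.inr ⟨hx, h⟩

lemma testBit_fullTable_of_mem {x : ℕ} (h : red (vec x) ∈ Lcode (ZMod 17)) :
    (fullTable 18).testBit (x % 2 ^ 18) = true := by
  refine testBit_fullTable (Nat.mod_lt _ (by norm_num)) 18 fun c hc => ?_
  rw [red_vec_mem_iff] at h
  have hs : ∀ i ∈ range 18, (sg (x % 2 ^ 18) i : ZMod 3) * (ut i c : ZMod 3) =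
      (sg x i : ZMod 3) * (ut i c : ZMod 3) := by
    intro i hi
    have hi : i < 18 := by simpa using hi
    simp only [sg, Nat.testBit_mod_two_pow, hi, decide_true, Bool.true_and]
  rw [Finset.sum_congr rfl hs, ← h c hc]
  rcases sg_eq_or x (c + 18) with e | e <;> rw [e] <;> decide

lemma eq_of_mem_of_mod_eq {x y : ℕ} (hx : red (vec x) ∈ Lcode (ZMod 17))
    (hy : red (vec y) ∈ Lcode (ZMod 17)) (h : x % 2 ^ 18 = y % 2 ^ 18) : vec x = vec y := by
  have hlo : ∀ i < 18, sg x i = sg y i := by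
    intro i hi
    have := congrArg (fun z => z.testBit i) h
    simp only [Nat.testBit_mod_two_pow, hi, decide_true, Bool.true_and] at this
    simp only [sg, this]
  rw [red_vec_mem_iff] at hx hy
  have hhi : ∀ c < 18, sg x (c + 18) = sg y (c + 18) := by
    intro c hc
    have e : (sg x (c + 18) : ZMod 3) = (sg y (c + 18) : ZMod 3) := by
      rw [hx c hc, hy c hc]
      exact Finset.sum_congr rfl fun i hi => by rw [hlo i (by simpa using hi)]
    rcases sg_eq_or x (c + 18) with h1 | h1 <;> rcases sg_eq_or y (c + 18) with h2 | h2 <;>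
      rw [h1, h2] at e ⊢ <;> exact absurd e (by decide)
  funext j
  unfold vec
  rcases j with j | j
  · exact hlo _ (pos_inl_lt j)
  · rw [pos_inr]
    exact hhi _ (pos_inl_lt j)

/-- Concatenate the entries of a list, each taking `s` bits. -/
def pack (s : ℕ) : List ℕ → ℕ
  | [] => 0
  | x :: l => x + pack s l <<< s

/-- Up to sign, the words of full weight of `L(17)`: first those which are not rows of `H`, in
breadth-first order under the action of the three automorphisms `gen`, then the rows of `H`. -/
def wordTable : ℕ := pack 36
  [29746528382, 6154338310, 33654155052, 4007870200, 53626785400, 34376327774, 65897405618,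
    19634279210, 64122777496, 6544934498, 9819546996, 60133689494, 36021309324, 47751131192,
    36828122100, 19634755932, 45361622004, 39230087726, 12052907078, 3273182332, 68555007404,
    22088373450, 17359063466, 24616566814, 6647070258, 50089909100, 38414287296, 50333466214,
    41106405922, 52956978014, 31947717838, 66093472466, 33867037402, 46297259022, 19481659582,
    15027327788, 55407821926, 47143163496, 54469815660, 38116439242, 48943860394, 18361031016,
    1031662426, 45639709260, 28754249474, 66786283324, 3773067932, 33966365558, 13617781594,
    45556519946, 37790479310, 16911792708, 1001967550, 19940948632, 11450870472, 38534094066,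
    24105814156, 34860591070, 64873307164, 58216508236, 59493056764, 27293649352, 47201501418,
    16218457862, 7545873720, 65571445686, 51498359146, 18784695916, 4590454362, 65475890488,
    17872586670, 46882281178, 41713483946, 48211628312, 44333919168, 22778391044, 11340536572,
    54832583448, 53336371312, 57849895668, 58542526400, 13293878374, 64488955572, 27445927538,
    9970474316, 60364892610, 50267161080, 9392479030, 27193289376, 31815369712, 19672487762,
    58831537492, 943594662, 53254978022, 26987456650, 528763858, 39881635122, 22166959584,
    54386578752, 9836374952, 68390800218, 42096691404, 26813523772, 61027661880, 27704042034,
    34277503702, 39277663700, 53566619872, 25567112402, 28980375610, 30817034432, 3077300226,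
    64778655446, 28803232256, 57432240844, 57960489076, 67406343528, 2063062708, 21519766122,
    30182708448, 15474430360, 18354125670, 37953790176, 30948860720, 11083479792, 51342921146,
    19885912124, 13172165732, 4937291752, 42812278926, 54587036560, 22151347214, 67734074804,
    64317362680, 13646955748, 20856873044, 34831535698, 60838096302, 59071132478, 63075596646,
    66748935018, 11075804678, 47956120912, 7188627904, 43536801202, 49056012034, 24066136106,
    56026496512, 52370130886, 8348711398, 32244608858, 10276667016, 65957280440, 27544805544,
    22559941786, 12033330196, 55024876612, 35898257408, 40220154586, 57671477984, 44875655692,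
    9180646580, 17949128704, 3765869624, 132453108, 42773146058, 30127410426, 35301140238,
    26178951566, 9207161596, 1431719256, 48849926172, 11720832438, 7513663894, 46145267098,
    13723225912, 53417826916, 63630739424, 40386060834, 51797392086, 49232871486, 11044317796,
    14377255808, 67097421468, 2003935100, 5541739896, 26708913458, 26783309936, 16827077526,
    39497809732, 25683788244, 22680811002, 16030694374, 67308310104, 32061388748, 5670268286,
    6546364664, 8456027426, 27235038902, 61872045602, 51133962662, 49423312508, 47714064024,
    48132010068, 63284555130, 45119621428, 20193161488, 31460341466, 40054205056, 13089606854,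
    27416422796, 44456056968, 59526340402, 63195346288, 14199752000, 21648081386, 61633544578,
    67618751614, 20553334032, 50482042796, 33809637950, 48761223424, 38593019738, 25241152470,
    11389195522, 13941862672, 7531214962, 57605940226, 2114269000, 1883065884, 2770869948,
    37194741438, 60254558710, 13092729328, 9874583504, 35744911198, 4696501658, 13406892958,
    33823323272, 62423676780, 53974651158, 67338247516, 715990700, 54547874564, 36654965548,
    8466824886, 22394087444, 48366100352, 39268296278, 40945690162, 24528268160, 66357626,
    2862914226, 43039270100, 57508236806, 40376272394, 37568867546, 51111544802, 62920158646,
    63467730342, 23441402732, 19638831850, 26343807178, 28398979714, 43295900630, 51775506216,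
    67646122258, 26587756748, 19948885888, 44787912746, 52357640990, 6854433378, 22885127752,
    14147007248, 51367052202, 54891330790, 56587504708, 55746180324, 53175513496, 64853352056,
    12308414478, 35996067390, 43334040576, 22004029418, 25671722716, 64426583114, 22819985702,
    33548710734, 51789902830, 9740960862, 68062647988, 6418258358, 18893608600, 19748904866,
    16696898510, 9817377966, 8015478258, 37632074544, 62232566386, 1057265572, 25045085622,
    41330538632, 33503875012, 28343943206, 29392547334, 55089348944, 28013248256, 39269249722,
    46980314602, 5725566308, 41168629164, 58337536680, 9446935372, 36721537746, 20584445654,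
    15091485296, 46623741376, 52687090070, 21032096792, 30123811274, 37786955056, 34875569580,
    55765877830, 60258434410, 32436653582, 6861744028, 66573029924, 19296640940, 34014627670,
    55075966148, 29168768340, 16500831662, 22901216658, 60247360404, 4228275856, 39771562106,
    48531709970, 58784570382, 39897509634, 36707989196, 42063931440, 67932468972, 18414061050,
    264644072, 39344713382, 38963057022, 45769731218, 41183085170, 1886665038, 12835992430,
    27883201058, 44007796694, 29415768746, 13708342470, 40454858528, 45802171172, 66518288636,
    26185196514, 66002015932, 63895173534, 12190502464, 44176746900, 20591804728, 33440956,
    57121102700, 44302432286, 56687362126, 14708015444, 67145461210, 28293752354, 68028731054,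
    41432979848, 22326242740, 33393272734, 61897459298, 51547902254, 16933649772, 10824171764,
    3323666200, 34717602646, 60108786868, 15062167780, 41063184846, 41459483296, 16905081118,
    23571581748, 59915510768, 33001139038, 30054393434, 15408648288, 44655509660, 46492665860,
    60987227378, 56797435142, 67007487880, 24266117128, 45522728666, 13493859396, 23875565596,
    52010308486, 56128138968, 24380742784, 4723598758, 44651961194, 8250677974, 4125601130,
    8109360002, 65295761168, 0, 12470142509, 24939760731, 49878997175, 31038779757, 62077035227,
    55434855861, 42150497129, 15581779665, 31163035043, 62325545799, 55931877005, 43144539417,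
    17569864241, 35139204195, 1559193797, 3117863307, 6235202327, 524286, 12470499792,
    24940737440, 49881212736, 31042948738, 62085635332, 55451793930, 42184111126, 15648745518,
    31297228892, 62594195640, 56468914546, 44218352358, 19717227982, 39434193820, 10148910906,
    20297559668, 40594857192]

/-- The full-weight word of a given number. -/
def W (n : ℕ) : ℕ := (wordTable >>> (36 * n)) % 2 ^ 36

lemma W_lt (n : ℕ) : W n < 2 ^ 36 := Nat.mod_lt _ (by norm_num)

/-- The `j`-th entry of a permutation stored with six bits per entry. -/
def fld (t j : ℕ) : ℕ := (t >>> (6 * j)) % 64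

/-- The monomial action of a permutation `g.1` and a sign vector `g.2`. -/
def act {R : Type} [Ring R] (g : ℕ × ℕ) (f : idx → R) : idx → R :=
  fun j => (sg g.2 (pos j) : R) * f (unpos (fld g.1 (pos j)))

/-- The first `n` bits of the image of the word `x` under the monomial action of `g`. -/
def actw (g : ℕ × ℕ) (x : ℕ) : ℕ → ℕ
  | 0 => 0
  | n + 1 => actw g x n + 2 ^ n * ((x >>> fld g.1 n ^^^ g.2 >>> n) % 2)

/-- Three automorphisms of `L(17)`. -/
def gen : ℕ → ℕ × ℕ
  | 0 => (35130630932015549304117779935012546272614938950410860590667141248, 0)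
  | 1 => (36954907153834470642114764998627842703245068377802241900233682945, 12470142509)
  | _ => (16816708358985556082394158960357751300709338317859618173572986003, 12470142509)

/-- A generator moving the word of a given number to one of smaller number, and that number. -/
def parentTable : ℕ := pack 11
  [0, 0, 512, 1024, 513, 1025, 2, 1026, 3, 515, 1028, 5, 517, 518, 1030, 7, 519, 520, 1032, 9,
    1033, 10, 522, 1035, 12, 1036, 13, 1037, 14, 526, 527, 1039, 16, 1040, 17, 1041, 18, 530,
    1043, 20, 532, 533, 1045, 22, 1046, 535, 536, 1048, 25, 537, 538, 1050, 27, 539, 540, 1052,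
    1053, 30, 1054, 31, 543, 544, 1056, 33, 546, 1058, 35, 548, 1060, 37, 1061, 38, 550, 551,
    1063, 40, 1064, 41, 1065, 42, 554, 555, 556, 45, 1069, 46, 1070, 47, 559, 560, 1072, 49, 1073,
    50, 1074, 51, 563, 564, 1076, 53, 1077, 1078, 55, 567, 56, 568, 569, 1081, 570, 571, 1083, 60,
    1084, 61, 1085, 62, 574, 575, 1087, 64, 1088, 65, 577, 578, 1090, 67, 1091, 68, 580, 581,
    1093, 70, 582, 583, 1095, 72, 1096, 1097, 586, 587, 76, 588, 1101, 78, 590, 591, 1103, 80, 81,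
    1105, 82, 1106, 595, 1107, 596, 597, 1109, 86, 598, 599, 1111, 1112, 89, 1113, 602, 603, 1115,
    92, 1117, 94, 606, 1119, 1120, 1121, 610, 1123, 100, 612, 101, 613, 614, 1126, 103, 616, 1128,
    1129, 1130, 107, 619, 1132, 109, 1133, 622, 623, 1135, 112, 624, 625, 1137, 626, 627, 1139,
    116, 1140, 117, 118, 120, 632, 633, 1145, 1146, 123, 636, 637, 1149, 126, 639, 1151, 128,
    1152, 129, 130, 642, 1155, 1156, 133, 1157, 134, 1159, 136, 648, 137, 138, 1163, 652, 141,
    654, 655, 1167, 144, 1168, 145, 1169, 146, 658, 1171, 661, 662, 1174, 663, 152, 1176, 665,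
    154, 1178, 155, 1179, 156, 668, 669, 158, 1182, 1183, 160, 673, 163, 164, 1189, 679, 1191,
    168, 681, 170, 1194, 171, 683, 685, 174, 1198, 175, 687, 1200, 177, 1201, 690, 1204, 693, 694,
    1206, 696, 186, 699, 1211, 189, 702, 1217, 194, 196, 1220, 197, 198, 710, 199, 713, 714, 1226,
    716, 1228, 718, 1230, 207, 208, 1232, 210, 723, 1235, 213, 1237, 214, 726, 727, 1240, 217,
    219, 731, 732, 1244, 222, 1246, 735, 224, 737, 1249, 226, 228, 740, 741, 1253, 230, 1254, 744,
    236, 1261, 238, 750, 240, 242, 754, 755, 1267, 1268, 245, 246, 1274, 763, 252, 1276, 765, 766,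
    1281, 1282, 1283, 774, 775, 1287, 264, 777, 269, 1294, 1295, 1296, 273, 786, 275, 276, 1304,
    283, 1308, 797, 286, 1313, 805, 294, 1318, 1320, 298, 301, 814, 1327, 305, 825, 829, 325, 838,
    1351, 1355, 1359, 342, 1367, 348, 862, 863, 353, 1378, 868, 358, 1400, 1403]

def parent (n : ℕ) : ℕ := (parentTable >>> (11 * n)) % 2 ^ 11

/-- `p` holds below `n`. -/
def allBelow (p : ℕ → Bool) : ℕ → Bool
  | 0 => true
  | n + 1 => p n && allBelow p n

lemma allBelow_iff (p : ℕ → Bool) (n : ℕ) : allBelow p n = true ↔ ∀ k < n, p k = true := by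
  induction n with
  | zero => simp [allBelow]
  | succ n ih =>
    rw [allBelow, Bool.and_eq_true, ih]
    constructor
    · rintro ⟨h1, h2⟩ k hk
      rcases Nat.lt_succ_iff_lt_or_eq.1 hk with h | rfl
      · exact h2 k h
      · exact h1
    · intro h
      exact ⟨h n (by omega), fun k hk => h k (by omega)⟩

lemma actw_lt (g : ℕ × ℕ) (x n : ℕ) : actw g x n < 2 ^ n := by
  induction n with
  | zero => simp [actw]
  | succ n ih =>
    have h : (x >>> fld g.1 n ^^^ g.2 >>> n) % 2 ≤ 1 := by omega
    have := Nat.mul_le_mul_left (2 ^ n) h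
    rw [actw, pow_succ]
    omega

lemma testBit_actw (g : ℕ × ℕ) (x n : ℕ) {j : ℕ} (hj : j < n) :
    (actw g x n).testBit j = (x.testBit (fld g.1 j) ^^ g.2.testBit j) := by
  induction n with
  | zero => omega
  | succ n ih =>
    rw [actw, Nat.add_comm, Nat.testBit_two_pow_mul_add _ (actw_lt g x n)]
    split_ifs with h
    · exact ih h
    · obtain rfl : j = n := by omega
      rw [Nat.sub_self, Nat.testBit_zero, Nat.mod_mod, ← Nat.testBit_zero, Nat.testBit_xor,
        Nat.testBit_shiftRight, Nat.testBit_shiftRight, Nat.add_zero, Nat.add_zero]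

lemma vec_actw (g : ℕ × ℕ) (hg : ∀ j < 36, fld g.1 j < 36) (x : ℕ) :
    vec (actw g x 36) = act g (vec x) := by
  funext j
  simp only [vec, act, sg, testBit_actw g x 36 (pos_lt j), pos_unpos _ (hg _ (pos_lt j))]
  cases x.testBit (fld g.1 (pos j)) <;> cases g.2.testBit (pos j) <;> rfl

lemma gen_fld_lt : ∀ i < 3, ∀ j < 36, fld (gen i).1 j < 36 := by decide +kernel

lemma parent_spec : ∀ k < 408, k = 0 ∨ parent k / 512 < 3 ∧ parent k % 512 < k ∧
    (actw (gen (parent k / 512)) (W k) 36 = W (parent k % 512) ∨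
      actw (gen (parent k / 512)) (W k) 36 = compl36 (W (parent k % 512))) := by
  have h : allBelow (fun k => decide (k = 0 ∨ parent k / 512 < 3 ∧ parent k % 512 < k ∧
    (actw (gen (parent k / 512)) (W k) 36 = W (parent k % 512) ∨
      actw (gen (parent k / 512)) (W k) 36 = compl36 (W (parent k % 512))))) 408 = true := by
    decide +kernel
  rw [allBelow_iff] at h
  exact fun k hk => of_decide_eq_true (h k hk)

lemma exists_parent {k : ℕ} (hk : k < 408) (h0 : k ≠ 0) : ∃ i < 3, ∃ p < k,
    act (gen i) (vec (W k)) = vec (W p) ∨ act (gen i) (vec (W k)) = - vec (W p) := by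
  obtain ⟨hi, hp, h⟩ := (parent_spec k hk).resolve_left h0
  refine ⟨_, hi, _, hp, ?_⟩
  rw [← vec_actw _ (gen_fld_lt _ hi), ← vec_compl (W_lt _)]
  exact h.imp (congrArg vec) (congrArg vec)

lemma gen_involutive : ∀ i < 3, ∀ j,
    unpos (fld (gen i).1 (pos (unpos (fld (gen i).1 (pos j))))) = j ∧
    sg (gen i).2 (pos j) * sg (gen i).2 (pos (unpos (fld (gen i).1 (pos j)))) =
      sg (gen i).2 0 * sg (gen i).2 (fld (gen i).1 0) := by
  decide +kernel

lemma act_neg (g : ℕ × ℕ) (f : idx → ℤ) : act g (-f) = - act g f := by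
  funext j
  simp [act]

lemma red_act (g : ℕ × ℕ) (f : idx → ℤ) : red (act g f) = act g (red f) := by
  funext j
  simp [red, act]

lemma act_act {i : ℕ} (hi : i < 3) (f : idx → ℤ) :
    act (gen i) (act (gen i) f) = f ∨ act (gen i) (act (gen i) f) = -f := by
  have h : act (gen i) (act (gen i) f) = fun j =>
      sg (gen i).2 0 * sg (gen i).2 (fld (gen i).1 0) * f j := by
    funext j
    obtain ⟨h1, h2⟩ := gen_involutive i hi j
    simp only [act, h1, ← h2, Int.cast_id]
    ring
  rw [h]
  rcases sg_eq_or (gen i).2 0 with e | e <;> rcases sg_eq_or (gen i).2 (fld (gen i).1 0) with e' | e' <;>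
    rw [e, e']
  · left; funext j; simp
  · right; funext j; simp
  · right; funext j; simp
  · left; funext j; simp

lemma eq_act_or {i : ℕ} (hi : i < 3) {f f' : idx → ℤ} (h : act (gen i) f = f' ∨ act (gen i) f = -f') :
    f = act (gen i) f' ∨ f = - act (gen i) f' := by
  rcases act_act hi f with e | e <;> rcases h with h | h <;> rw [h] at e
  · exact Or.inl e.symm
  · rw [act_neg] at e
    exact Or.inr e.symm
  · exact Or.inr (by rw [e, neg_neg])
  · rw [act_neg, neg_inj] at e
    exact Or.inl e.symm

lemma act_genRowL_mem : ∀ i < 3, ∀ r, act (gen i) (genRowL (ZMod 17) r) ∈ Lcode (ZMod 17) := by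
  simp only [mem_Lcode_iff, Umat_eq]
  decide +kernel

lemma act_mem {i : ℕ} (hi : i < 3) {f : idx → ZMod 3} (hf : f ∈ Lcode (ZMod 17)) :
    act (gen i) f ∈ Lcode (ZMod 17) := by
  induction hf using Submodule.span_induction with
  | mem f h =>
    obtain ⟨r, rfl⟩ := h
    exact act_genRowL_mem i hi r
  | zero =>
    convert Submodule.zero_mem _
    funext j
    simp [act]
  | add f f' _ _ h h' =>
    convert Submodule.add_mem _ h h'
    funext j
    simp [act, mul_add]
  | smul c f _ h =>
    convert Submodule.smul_mem _ c h
    funext j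
    simp [act, mul_left_comm]

lemma W_zero_mem : red (vec (W 0)) ∈ Lcode (ZMod 17) := by
  rw [red_vec_mem_iff]
  decide +kernel

lemma Hmat_unpos : ∀ i < 36, ∀ j < 36, Hmat (ZMod 17) (unpos i) (unpos j) = sg (W (408 + i)) j := by
  decide +kernel

lemma Hmat_row (i : idx) : Hmat (ZMod 17) i = vec (W (408 + pos i)) := by
  funext j
  have := Hmat_unpos (pos i) (pos_lt i) (pos j) (pos_lt j)
  rwa [unpos_pos, unpos_pos] at this

lemma red_Hmat_mem (i : idx) : red (vec (W (408 + pos i))) ∈ Lcode (ZMod 17) := by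
  rw [red_vec_mem_iff]
  revert i
  decide +kernel

lemma red_W_mem {k : ℕ} (hk : k < 408) : red (vec (W k)) ∈ Lcode (ZMod 17) := by
  induction k using Nat.strong_induction_on with
  | _ k ih =>
    rcases eq_or_ne k 0 with rfl | h0
    · exact W_zero_mem
    · obtain ⟨i, hi, p, hp, h⟩ := exists_parent hk h0
      have := act_mem hi (ih p hp (hp.trans hk))
      rw [← red_act] at this
      rcases eq_act_or hi h with e | e <;> rw [e]
      · exact this
      · rw [red_neg]
        exact Submodule.neg_mem _ this

lemma red_W_mem' {k : ℕ} (hk : k < 444) : red (vec (W k)) ∈ Lcode (ZMod 17) := by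
  rcases lt_or_ge k 408 with h | h
  · exact red_W_mem h
  · have := red_Hmat_mem (unpos (k - 408))
    rwa [pos_unpos _ (by omega), Nat.add_sub_cancel' h] at this

/-- Add to the table `c` the left halves of the first `n` words and of their complements. -/
def coverTable : ℕ → ℕ → ℕ
  | 0, c => c
  | n + 1, c => force ((c ||| 2 ^ (W n % 2 ^ 18)) ||| 2 ^ (compl36 (W n) % 2 ^ 18)) (coverTable n)

lemma testBit_coverTable (x n : ℕ) : ∀ c, (coverTable n c).testBit x = true → c.testBit x = true ∨
    ∃ k < n, x = W k % 2 ^ 18 ∨ x = compl36 (W k) % 2 ^ 18 := by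
  induction n with
  | zero => exact fun c h => Or.inl h
  | succ n ih =>
    intro c h
    rw [coverTable, force_eq] at h
    rcases ih _ h with h | ⟨k, hk, h⟩
    · rw [Nat.testBit_or, Nat.testBit_or, Bool.or_eq_true, Bool.or_eq_true, Nat.testBit_two_pow,
        Nat.testBit_two_pow, decide_eq_true_eq, decide_eq_true_eq] at h
      rcases h with (h | h) | h
      · exact Or.inl h
      · exact Or.inr ⟨n, by omega, Or.inl h.symm⟩
      · exact Or.inr ⟨n, by omega, Or.inr h.symm⟩
    · exact Or.inr ⟨k, by omega, h⟩

lemma fullTable_eq : fullTable 18 = coverTable 444 0 := by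
  decide +kernel

/-- The full-weight words of `L(17)` are the words of the table and their negatives. -/
lemma exists_word {f : idx → ℤ} (hf : ∀ j, f j = 1 ∨ f j = -1) (hL : red f ∈ Lcode (ZMod 17)) :
    ∃ k < 444, f = vec (W k) ∨ f = - vec (W k) := by
  obtain ⟨x, -, rfl⟩ := exists_vec f hf
  have h := testBit_fullTable_of_mem hL
  rw [fullTable_eq] at h
  rcases testBit_coverTable _ _ _ h with h | ⟨k, hk, h⟩
  · simp at h
  · refine ⟨k, hk, h.imp (eq_of_mem_of_mod_eq hL (red_W_mem' hk)) fun h => ?_⟩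
    rw [← vec_compl (W_lt k)]
    refine eq_of_mem_of_mod_eq hL ?_ h
    rw [vec_compl (W_lt k), red_neg]
    exact Submodule.neg_mem _ (red_W_mem' hk)

/-- Concatenate `f 0, …, f (m - 1)`, each taking six bits. -/
def packf (f : ℕ → ℕ) : ℕ → ℕ
  | 0 => 0
  | m + 1 => packf f m + f m <<< (6 * m)

lemma packf_add (f g : ℕ → ℕ) (m : ℕ) : packf f m + packf g m = packf (fun n => f n + g n) m := by
  induction m with
  | zero => rfl
  | succ m ih =>
    simp only [packf, ← ih, Nat.shiftLeft_eq]
    ring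

lemma packf_lt {f : ℕ → ℕ} (hf : ∀ n, f n < 64) (m : ℕ) : packf f m < 2 ^ (6 * m) := by
  induction m with
  | zero => simp [packf]
  | succ m ih =>
    have := Nat.mul_le_mul_left (2 ^ (6 * m)) (Nat.le_of_lt_succ (hf m))
    have e : 2 ^ (6 * (m + 1)) = 2 ^ (6 * m) * 64 := by
      rw [mul_add, pow_add]
      norm_num
    rw [packf, Nat.shiftLeft_eq, e, mul_comm (f m)]
    omega

lemma testBit_packf {f : ℕ → ℕ} (hf : ∀ n, f n < 64) {m n t : ℕ} (hn : n < m) (ht : t < 6) :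
    (packf f m).testBit (6 * n + t) = (f n).testBit t := by
  induction m with
  | zero => omega
  | succ m ih =>
    rw [packf, Nat.shiftLeft_eq, mul_comm (f m), Nat.add_comm,
      Nat.testBit_two_pow_mul_add _ (packf_lt hf m)]
    rcases Nat.lt_succ_iff_lt_or_eq.1 hn with h | rfl
    · rw [if_pos (by omega), ih h]
    · rw [if_neg (by omega), Nat.add_sub_cancel_left]

/-- The bits at position `j` of all words. -/
def plane (j : ℕ) : ℕ := packf (fun n => (W n >>> j) % 2) 444

def ones : ℕ := packf (fun _ => 1) 444

/-- The distances from `w` to all words, given the list of planes and `F = ones`. -/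
def dist (F : ℕ) (l : List ℕ) : ℕ → ℕ :=
  List.rec (fun _ => 0) (fun p _ ih w =>
    Nat.add (ih (Nat.div w 2)) (Nat.rec p (fun _ _ => Nat.sub F p) (Nat.mod w 2))) l

lemma dist_cons (F p : ℕ) (l : List ℕ) (w : ℕ) : dist F (p :: l) w =
    dist F l (w / 2) + if w % 2 = 0 then p else F - p := by
  change dist F l (w / 2) + Nat.rec p (fun _ _ => F - p) (w % 2) = _
  rcases Nat.mod_two_eq_zero_or_one w with h | h <;> rw [h] <;> rfl

/-- Whether `w` and `x` differ at position `j`, as a number. -/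
def bitDiff (w x j : ℕ) : ℕ := (w >>> j ^^^ x >>> j) % 2

/-- The number of the first `n` bits in which `w` and `x` differ. -/
def ham (w x : ℕ) : ℕ → ℕ
  | 0 => 0
  | n + 1 => ham w x n + bitDiff w x n

lemma bitDiff_eq (w x j : ℕ) : bitDiff w x j = (w.testBit j ^^ x.testBit j).toNat := by
  rw [bitDiff, ← Nat.shiftRight_xor_distrib, Nat.shiftRight_eq_div_pow, ← Nat.toNat_testBit,
    Nat.testBit_xor]

lemma ham_eq_sum (w x n : ℕ) : ham w x n = ∑ j ∈ range n, bitDiff w x j := by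
  induction n with
  | zero => simp [ham]
  | succ n ih => rw [Finset.sum_range_succ, ham, ih]

lemma ham_le (w x n : ℕ) : ham w x n ≤ n := by
  induction n with
  | zero => simp [ham]
  | succ n ih =>
    rw [ham, bitDiff]
    omega

lemma vec_dotProduct (w x : ℕ) : vec w ⬝ᵥ vec x = 36 - 2 * ham w x 36 := by
  have h : ∀ j, sg w j * sg x j = 1 - 2 * (bitDiff w x j : ℤ) := by
    intro j
    rw [bitDiff_eq]
    unfold sg
    cases w.testBit j <;> cases x.testBit j <;> rfl
  have e : vec w ⬝ᵥ vec x = ∑ j ∈ range 36, sg w j * sg x j := sum_pos fun j => sg w j * sg x j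
  simp only [e, h, Finset.sum_sub_distrib, ← Finset.mul_sum, ham_eq_sum, Finset.sum_const,
    Finset.card_range]
  push_cast
  ring

lemma packf_zero (m : ℕ) : packf (fun _ => 0) m = 0 := by
  induction m with
  | zero => rfl
  | succ m ih => simp [packf, ih]

lemma packf_compl {f : ℕ → ℕ} (hf : ∀ n, f n ≤ 1) (m : ℕ) :
    packf (fun _ => 1) m - packf f m = packf (fun n => 1 - f n) m := by
  have h := packf_add (fun n => 1 - f n) f m
  rw [show (fun n => 1 - f n + f n) = fun _ => 1 from funext fun n => Nat.sub_add_cancel (hf n)] at h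
  rw [← h, Nat.add_sub_cancel]

lemma plane_step (w j : ℕ) : (if (w >>> j) % 2 = 0 then plane j else ones - plane j) =
    packf (fun n => bitDiff w (W n) j) 444 := by
  have e : ∀ n, bitDiff w (W n) j = ((w >>> j) % 2 + (W n >>> j) % 2) % 2 := fun n => by
    rw [bitDiff, Nat.xor_mod_two_eq, ← Nat.add_mod]
  simp only [e]
  rcases Nat.mod_two_eq_zero_or_one (w >>> j) with h | h <;> rw [h]
  · simp only [Nat.zero_add, Nat.mod_mod, plane, if_true]
  · have e' : ∀ n, (1 + (W n >>> j) % 2) % 2 = 1 - (W n >>> j) % 2 := fun n => by omega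
    simp only [e', plane, ones, one_ne_zero, if_false]
    rw [packf_compl fun n => by omega]

lemma dist_range' (w m : ℕ) : ∀ j, dist ones ((List.range' j m).map plane) (w >>> j) =
    packf (fun n => ∑ i ∈ range m, bitDiff w (W n) (j + i)) 444 := by
  induction m with
  | zero =>
    intro j
    rw [show (fun n => ∑ i ∈ range 0, bitDiff w (W n) (j + i)) = fun _ => 0 from rfl, packf_zero]
    rfl
  | succ m ih =>
    intro j
    rw [List.range'_succ, List.map_cons, dist_cons, ← Nat.shiftRight_succ, ih, plane_step, packf_add]
    simp only [Finset.sum_range_succ' _ m, Nat.add_zero, Nat.add_right_comm j 1, ← Nat.add_assoc]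

lemma testBit_dist (w : ℕ) {n t : ℕ} (hn : n < 444) (ht : t < 6) :
    (dist ones ((List.range 36).map plane) w).testBit (6 * n + t) =
      (ham w (W n) 36).testBit t := by
  have := dist_range' w 36 0
  rw [Nat.shiftRight_zero] at this
  rw [List.range_eq_range', this]
  simp only [Nat.zero_add, ← ham_eq_sum]
  exact testBit_packf (fun n => (ham_le _ _ _).trans_lt (by norm_num)) hn ht

lemma testBit_ones {n : ℕ} (hn : n < 444) : ones.testBit (6 * n) = true :=
  testBit_packf (t := 0) (fun _ => by norm_num) hn (by norm_num)

/-- The list `l`, with its entries evaluated first by the kernel. -/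
def forceList {α : Type} : List ℕ → (List ℕ → α) → α
  | [], k => k []
  | x :: l, k => force x fun y => forceList l fun l' => k (y :: l')

@[simp] lemma forceList_eq {α : Type} (l : List ℕ) : ∀ k : List ℕ → α, forceList l k = k l := by
  induction l with
  | nil => exact fun _ => rfl
  | cons x l ih =>
    intro k
    rw [forceList, force_eq, ih]
/-- The bits at positions `6 * n` for which the digit of `d` in base 64 is not a multiple of 6
less than 36, apart from 6 and 30. -/
def badDigits (d : ℕ) : ℕ :=
  d ||| d >>> 5 ||| (d >>> 1 &&& d >>> 2) ||| (d >>> 1 &&& d >>> 3) ||| (d >>> 2 &&& d >>> 4) |||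
    (d >>> 1 ^^^ d >>> 2 ^^^ d >>> 3 ^^^ d >>> 4)

/-- Evaluate the planes and `ones` before use. -/
def withPlanes {α : Type} (k : ℕ → List ℕ → α) : α :=
  force ones fun F => forceList ((List.range 36).map plane) fun pl => k F pl

@[simp] lemma withPlanes_eq {α : Type} (k : ℕ → List ℕ → α) :
    withPlanes k = k ones ((List.range 36).map plane) := by
  simp [withPlanes]

/-- The word of number `a` is at distance 0, 12, 18 or 24 from the first 408 words, and at odd
distance from the rows of `H`. -/
def distancesOK (F : ℕ) (pl : List ℕ) (a : ℕ) : Bool :=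
  force (dist F pl (W a)) fun d =>
    Nat.beq (badDigits d &&& (F ^^^ F >>> 2448 <<< 2448)) 0 &&
      Nat.beq (d >>> 2448 &&& F >>> 2448) (F >>> 2448)

lemma distances : withPlanes (fun F pl => allBelow (distancesOK F pl) 408) = true := by
  decide +kernel

lemma badDigits_spec {h d n : ℕ} (hh : h < 64)
    (hd : ∀ t < 6, d.testBit (6 * n + t) = h.testBit t)
    (hb : (badDigits d).testBit (6 * n) = false) : h = 0 ∨ h = 12 ∨ h = 18 ∨ h = 24 := by
  have h0 := hd 0 (by norm_num)
  have h1 := hd 1 (by norm_num)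
  have h2 := hd 2 (by norm_num)
  have h3 := hd 3 (by norm_num)
  have h4 := hd 4 (by norm_num)
  have h5 := hd 5 (by norm_num)
  simp only [badDigits, Nat.testBit_or, Nat.testBit_and, Nat.testBit_xor, Nat.testBit_shiftRight,
    Nat.add_comm _ (6 * n), h1, h2, h3, h4, h5] at hb
  rw [Nat.add_zero] at h0
  rw [h0] at hb
  clear hd h0 h1 h2 h3 h4 h5
  revert h
  decide +kernel

lemma ham_lt (w x : ℕ) : ham w x 36 < 64 := (ham_le _ _ _).trans_lt (by norm_num)

lemma distancesOK_of_lt {a : ℕ} (ha : a < 408) :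
    distancesOK ones ((List.range 36).map plane) a = true := by
  have h := distances
  rw [withPlanes_eq, allBelow_iff] at h
  exact h a ha

lemma ham_word_word {a b : ℕ} (ha : a < 408) (hb : b < 408) : ham (W a) (W b) 36 = 0 ∨
    ham (W a) (W b) 36 = 12 ∨ ham (W a) (W b) 36 = 18 ∨ ham (W a) (W b) 36 = 24 := by
  have h := distancesOK_of_lt ha
  rw [distancesOK, force_eq, Bool.and_eq_true] at h
  refine badDigits_spec (ham_lt _ _) (fun t ht => testBit_dist (W a) (show b < 444 by omega) ht) ?_
  have := congrArg (fun x => x.testBit (6 * b)) (Nat.eq_of_beq_eq_true h.1)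
  simpa [Nat.testBit_and, Nat.testBit_xor, Nat.testBit_shiftLeft, testBit_ones (show b < 444 by omega),
    show ¬ 2448 ≤ 6 * b by omega] using this

lemma ham_word_row {a b : ℕ} (ha : a < 408) (hb : 408 ≤ b) (hb' : b < 444) :
    ham (W a) (W b) 36 % 2 = 1 := by
  have h := distancesOK_of_lt ha
  rw [distancesOK, force_eq, Bool.and_eq_true] at h
  have := congrArg (fun x => x.testBit (6 * (b - 408))) (Nat.eq_of_beq_eq_true h.2)
  simp only [Nat.testBit_and, Nat.testBit_shiftRight, show 2448 + 6 * (b - 408) = 6 * b by omega,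
    testBit_ones hb', Bool.and_true] at this
  rw [← Nat.add_zero (6 * b), testBit_dist (W a) hb' (by norm_num)] at this
  exact Nat.mod_two_eq_one_iff_testBit_zero.2 this

/-- The number `1 + 4096 + ⋯ + 4096 ^ (k - 1)`. -/
def comb : ℕ → ℕ
  | 0 => 0
  | k + 1 => 1 + 4096 * comb k

lemma land_comb_succ (y k : ℕ) :
    y &&& comb (k + 1) = y % 2 + 4096 * (y / 4096 &&& comb k) := by
  have h1 : (y &&& comb (k + 1)) / 2 ^ 12 = y / 4096 &&& comb k := by
    rw [Nat.and_div_two_pow, comb]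
    congr 1
    omega
  have h2 : (y &&& comb (k + 1)) % 2 ^ 12 = y % 2 := by
    rw [Nat.and_mod_two_pow, comb, show (1 + 4096 * comb k) % 2 ^ 12 = 1 by omega,
      Nat.and_one_is_mod]
    omega
  omega

lemma land_comb_mod {k : ℕ} (hk : k < 4095) (y : ℕ) :
    (y &&& comb k) % 4095 = #{m ∈ range k | y.testBit (12 * m) = true} := by
  have h : ∀ k y : ℕ, (y &&& comb k) % 4095 =
      (∑ m ∈ range k, if y.testBit (12 * m) = true then 1 else 0) % 4095 := by
    intro k
    induction k with
    | zero => simp [comb]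
    | succ k ih =>
      intro y
      have e : ∀ m, y.testBit (12 * (m + 1)) = (y / 4096).testBit (12 * m) := fun m => by
        rw [show 4096 = 2 ^ 12 by norm_num, Nat.testBit_div_two_pow]
        congr 1
      have e0 : (if y.testBit (12 * 0) = true then 1 else 0) = y % 2 := by
        simp only [mul_zero, Nat.testBit_zero, decide_eq_true_eq]
        split_ifs <;> omega
      rw [Finset.sum_range_succ', e0, land_comb_succ]
      simp only [e]
      have := ih (y / 4096)
      omega
  rw [h, ← Finset.card_filter]
  exact Nat.mod_eq_of_lt (((Finset.card_filter_le _ _).trans_eq (Finset.card_range k)).trans_lt hk)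

/-- At most eight of the bits of `x` at positions `64 + 6 * n` are nonzero. -/
def few (M x : ℕ) : Bool :=
  Nat.ble ((x >>> 64 &&& M) % 4095 + (x >>> 70 &&& M) % 4095) 8

lemma few_spec {x : ℕ} (h : few (comb 256) x = true) (S : Finset ℕ)
    (hS : ∀ n ∈ S, n < 512 ∧ x.testBit (64 + 6 * n) = true) : #S ≤ 8 := by
  rw [few, Nat.ble_eq, land_comb_mod (by norm_num), land_comb_mod (by norm_num)] at h
  have h0 : ∀ r < 2, #{n ∈ S | n % 2 = r} ≤
      #{m ∈ range 256 | (x >>> (64 + 6 * r)).testBit (12 * m) = true} := by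
    intro r hr
    refine Finset.card_le_card_of_injOn (· / 2) (fun n hn => ?_) fun n hn n' hn' e => ?_
    · obtain ⟨hn, e⟩ := Finset.mem_filter.1 hn
      obtain ⟨h1, h2⟩ := hS n hn
      simp only [Finset.coe_filter, Set.mem_ofPred_eq, Finset.mem_range, Nat.testBit_shiftRight]
      refine ⟨by omega, ?_⟩
      rwa [show 64 + 6 * r + 12 * (n / 2) = 64 + 6 * n by omega]
    · have h1 := (Finset.mem_filter.1 hn).2
      have h2 := (Finset.mem_filter.1 hn').2
      have e : n / 2 = n' / 2 := e
      omega
  have h1 : _ ≤ #{m ∈ range 256 | (x >>> 64).testBit (12 * m) = true} := h0 0 (by norm_num)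
  have h2 : _ ≤ #{m ∈ range 256 | (x >>> 70).testBit (12 * m) = true} := h0 1 (by norm_num)
  have h3 := Finset.card_filter_add_card_filter_not (s := S) fun n => n % 2 = 0
  simp only [Nat.mod_two_not_eq_zero] at h3
  omega

/-- The position of the first nonzero bit of a number with less than `2 ^ k` bits. -/
def topBit : ℕ → ℕ → ℕ
  | 0, _ => 0
  | k + 1, x => force (x >>> (1 <<< k)) fun y =>
    match Nat.beq y 0 with
    | true => topBit k x
    | false => force (topBit k y) fun l => 1 <<< k + l

/-- `p` holds for the positions of all nonzero bits of `x`, of which there are at most `k`. -/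
def allBits (p : ℕ → Bool) : ℕ → ℕ → Bool
  | 0, x => Nat.beq x 0
  | k + 1, x => Nat.beq x 0 ||
    force (topBit 12 x) fun l => p l && force (x ^^^ 1 <<< l) fun y => allBits p k y

lemma allBits_spec {p : ℕ → Bool} {k x : ℕ} (h : allBits p k x = true) {i : ℕ}
    (hi : x.testBit i = true) : p i = true := by
  induction k generalizing x with
  | zero =>
    obtain rfl := Nat.eq_of_beq_eq_true h
    simp at hi
  | succ k ih =>
    rw [allBits, Bool.or_eq_true, force_eq, force_eq, Bool.and_eq_true] at h
    rcases h with h | ⟨h1, h2⟩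
    · obtain rfl := Nat.eq_of_beq_eq_true h
      simp at hi
    · by_cases e : i = topBit 12 x
      · rw [e]
        exact h1
      · refine ih h2 ?_
        rw [Nat.testBit_xor, hi, Nat.one_shiftLeft, Nat.testBit_two_pow_of_ne fun e' => e e'.symm]
        rfl

/-- The set `x` with the word of number `n` removed. Sets of words are represented by numbers, with
the word of number `n` corresponding to the bit at position `64 + 6 * n`; the first 64 bits are used
to make the numbers distinct modulo `2 ^ 64`, on which the hashing of numbers depends. -/
def clear (x n : ℕ) : ℕ := x ^^^ (x &&& 1 <<< (64 + 6 * n)) ^^^ (n + 1) * 16045690984503 % 2 ^ 64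

/-- The set `x` with the elements of the set `y` removed; `n` is used for the first 64 bits only. -/
def remove (x y n : ℕ) : ℕ := x ^^^ (x &&& y) ^^^ (n + 1) * 3405691582716057 % 2 ^ 64

/-- Verify an exhaustive search. An element of the stack `st` is a set `P` of words and stands for
the cliques contained in `P`. The neighbours of a word in a set `nb` are those which cannot occur
together with it, and a maximal clique contains at least nine neighbours of any word outside it. -/
noncomputable def search (M : ℕ) (nb : ℕ → ℕ) (leaf : ℕ → ℕ → Bool) (ts : List ℕ) : List ℕ → Bool :=
  List.rec (List.rec true fun _ _ _ => false)
    (fun t _ ih => List.rec true fun P st _ => force (t / 512) fun a => force (t % 512) fun b =>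
      match Nat.blt b 408 with
      | true => !Nat.testBit (clear P a) (64 + 6 * b) && (few M (clear P a &&& nb b) &&
          force (remove P (nb a) a) fun R => ih (R :: st))
      | false => match Nat.beq b 408 with
        | true => force (remove P (nb a) a) fun R => force (clear P a) fun Q => ih (R :: Q :: st)
        | false => match Nat.beq b 409 with
          | true => Nat.blt a 408 && (!Nat.testBit P (64 + 6 * a) && (few M (P &&& nb a) && ih st))
          | false => leaf a P && ih st) ts

lemma search_cons (M : ℕ) (nb : ℕ → ℕ) (leaf : ℕ → ℕ → Bool) (t : ℕ) (ts : List ℕ) (P : ℕ)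
    (st : List ℕ) : search M nb leaf (t :: ts) (P :: st) =
    force (t / 512) fun a => force (t % 512) fun b =>
      match Nat.blt b 408 with
      | true => !Nat.testBit (clear P a) (64 + 6 * b) && (few M (clear P a &&& nb b) &&
          force (remove P (nb a) a) fun R => search M nb leaf ts (R :: st))
      | false => match Nat.beq b 408 with
        | true => force (remove P (nb a) a) fun R => force (clear P a) fun Q => search M nb leaf ts (R :: Q :: st)
        | false => match Nat.beq b 409 with
          | true => Nat.blt a 408 && (!Nat.testBit P (64 + 6 * a) && (few M (P &&& nb a) && search M nb leaf ts st))
          | false => leaf a P && search M nb leaf ts st := rfl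

lemma testBit_xor_mod (x y : ℕ) {i : ℕ} (h : 64 ≤ i) :
    (x ^^^ y % 2 ^ 64).testBit i = x.testBit i := by
  rw [Nat.testBit_xor, Nat.testBit_mod_two_pow, decide_eq_false (by omega), Bool.false_and,
    Bool.xor_false]

/-- The set `P` contains the set `S`. -/
def Contains (P : ℕ) (S : Finset ℕ) : Prop := ∀ n ∈ S, P.testBit (64 + 6 * n) = true

lemma Contains.clear {P a : ℕ} {S : Finset ℕ} (h : Contains P S) (ha : a ∉ S) :
    Contains (clear P a) S := by
  intro n hn
  have e : 64 + 6 * a ≠ 64 + 6 * n := by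
    rintro e
    obtain rfl : n = a := by omega
    exact ha hn
  rw [PlessCode.clear, testBit_xor_mod _ _ (by omega), Nat.testBit_xor, Nat.testBit_and,
    Nat.one_shiftLeft, Nat.testBit_two_pow_of_ne e, h n hn]
  rfl

section Search

variable {nb : ℕ → ℕ} {S : Finset ℕ}

lemma Contains.remove {P a : ℕ} (h : Contains P S) (c : ℕ)
    (hS : ∀ b ∈ S, (nb a).testBit (64 + 6 * b) = false) : Contains (remove P (nb a) c) S := by
  intro n hn
  rw [PlessCode.remove, testBit_xor_mod _ _ (by omega), Nat.testBit_xor, Nat.testBit_and, h n hn,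
    hS n hn]
  rfl

lemma Contains.mem_of_few {P b : ℕ} (h : Contains P S) (hlt : ∀ n ∈ S, n < 408)
    (hS : b ∉ S → 9 ≤ #{n ∈ S | (nb b).testBit (64 + 6 * n) = true})
    (hb : few (comb 256) (P &&& nb b) = true) : b ∈ S := by
  by_contra hbS
  have h1 := few_spec hb {n ∈ S | (nb b).testBit (64 + 6 * n) = true} fun n hn => by
    rw [Finset.mem_filter] at hn
    have := hlt n hn.1
    rw [Nat.testBit_and, h n hn.1, hn.2]
    exact ⟨by omega, rfl⟩
  have := hS hbS
  omega

theorem search_sound {leaf : ℕ → ℕ → Bool} (hlt : ∀ n ∈ S, n < 408)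
    (hcl : ∀ a ∈ S, ∀ b ∈ S, (nb a).testBit (64 + 6 * b) = false)
    (hmax : ∀ b < 408, b ∉ S → 9 ≤ #{n ∈ S | (nb b).testBit (64 + 6 * n) = true})
    (ts st : List ℕ) (h : search (comb 256) nb leaf ts st = true)
    (hst : ∃ P ∈ st, Contains P S) : ∃ a P, leaf a P = true ∧ Contains P S := by
  induction ts generalizing st with
  | nil =>
    cases st with
    | nil => simp at hst
    | cons => simp [search] at h
  | cons t ts ih =>
    cases st with
    | nil => simp at hst
    | cons P st =>
      rw [search_cons, force_eq, force_eq] at h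
      generalize t / 512 = a at h
      generalize t % 512 = b at h
      rw [List.exists_mem_cons_iff] at hst
      split at h
      · rename_i hb
        rw [Bool.and_eq_true, Bool.and_eq_true, force_eq] at h
        obtain ⟨h1, h2, h3⟩ := h
        refine ih _ h3 (List.exists_mem_cons_iff _ _ _ |>.2 (hst.imp_left fun hP => ?_))
        by_cases ha : a ∈ S
        · exact hP.remove _ (hcl a ha)
        · have hQ := hP.clear ha
          have := hQ _ (hQ.mem_of_few hlt (hmax b (by simpa [Nat.blt_eq] using hb)) h2)
          simp [this] at h1
      · split at h
        · rw [force_eq, force_eq] at h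
          refine ih _ h ?_
          simp only [List.exists_mem_cons_iff]
          rcases hst with hP | hst
          · by_cases ha : a ∈ S
            · exact Or.inl (hP.remove _ (hcl a ha))
            · exact Or.inr (Or.inl (hP.clear ha))
          · exact Or.inr (Or.inr hst)
        · split at h
          · simp only [Bool.and_eq_true] at h
            obtain ⟨h1, h2, h3, h4⟩ := h
            refine ih _ h4 (hst.resolve_left fun hP => ?_)
            have := hP _ (hP.mem_of_few hlt (hmax a (by simpa [Nat.blt_eq] using h1)) h3)
            simp [this] at h2
          · rw [Bool.and_eq_true] at h
            rcases hst with hP | hst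
            · exact ⟨_, _, h.1, hP⟩
            · exact ih _ h.2 hst

end Search

/-- The numbers of the words forming the second Hadamard matrix. -/
def secondRows : ℕ := pack 9
  [0, 9, 16, 31, 35, 39, 41, 42, 43, 44, 81, 106, 107, 120, 125, 137, 138, 149, 151, 198, 213,
    218, 235, 246, 252, 279, 284, 302, 311, 319, 336, 337, 354, 363, 391, 399]

/-- The number of the word at a given position of the second Hadamard matrix. -/
def secondRow (i : ℕ) : ℕ := (secondRows >>> (9 * i)) % 512

/-- Monomial transformations, one for each solution of the search. -/
def leafGens : List (ℕ × ℕ) :=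
  [(58480294995590838871809355760848987863654520096450048174477549632, 0),
    (42021155874072494746500056912403385980974379758679216941191713345, 37680696978),
    (9873850545535243864723857056761797047991459258276240331250738646, 3117863307),
    (35057967695764793596155370995559617604083965345470908313320583488, 0),
    (33487599566547675266393423590212722621153713429317882775349006988, 31038779757),
    (18312321213314697804357663305980663260188186173444550668917220692, 43779716004),
    (23166479127762573554280508922090146356923024994014840355083117727, 56249334226),
    (30298624145911483810047840249944112348154481227232919730670318346, 28124619543),
    (56577197395944796566645082024176137578369783209321092499538485261, 56249334226),
    (28232784525954891076190033513923551194655777282962998364489766171, 62085635332),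
    (38496826590260605134041077844389695678348960841102509473795687043, 10148910906),
    (15200115640205266866096816674007660589675765371468087089915054301, 62085635332),
    (37033621820931990653597729984407822913787470009368517052652101639, 56249334226),
    (15124105818447024392061976569068261851667529070204548752157267474, 68719476735),
    (24994754058156776070566603745080252414134572783418961093185594578, 68719476735),
    (3604789871141993504152564039256836918281810380205612808479266451, 31038779757),
    (50197690328720073232705638211089354366090699864893826406155620676, 43144539417),
    (16892171665221441477613529340046647324445370358259970469647750421, 58570565829),
    (23352494842095179803988965972323504098644960756867405220665722012, 12470142509),
    (6944892189214052958239708846472329580227804013195606724472026962, 68719476735),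
    (11576859829757661354210501681339509667117663545136294845723543187, 42150497129),
    (24892694342187007812784346438319501083312891210448576931969726164, 51149612494),
    (51715097583335589586000892023622411628300775806927155938789687809, 43779716004),
    (46857261028162594637891952440506693763814920075179147438024040901, 62085635332)]

/-- The monomial transformation of number `a` takes all words in the set `P` to words in the list
`ms`, up to sign. -/
def leafOK (ms : List ℕ) (a P : ℕ) : Bool :=
  allBits (fun l => force (actw (leafGens.getD a (gen 0)) (W (l / 6)) 36) fun w =>
    ms.any (Nat.beq w) || force (compl36 w) fun w' => ms.any (Nat.beq w')) 36 (P >>> 64)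

/-- Split `c` into `n` numbers of 18 bits, followed by the list `l`. -/
def chunk (l : List ℕ) : ℕ → ℕ → List ℕ
  | 0, _ => l
  | n + 1, c => c % 262144 :: chunk l n (c / 262144)

/-- The steps of the search, in groups of twenty. -/
def steps : List ℕ :=
  [317427400139122579130812163859134389500585707037511169382877945050592186911721371639053104420838289468035992,
    476131810461082495808370435293060138711070878308227585912921854723109252796993942765815217494761649085665177,
    1283437299578663738872157518829131089957828319217372801020784543374711491011343442096197268657225778363425688,
    719227160570685341410526544009070603535856262426614101355217116513953204824145168885861930660309339166763928,
    86234718502325407293802408825066238911264697447755764960116094135270435611249242121458686902295942066611609,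
    86235505912586358775756280053979090392108024911160237031377344590284603315982912064784090391889084135284632,
    1191690167649933366123389731176293692352188667706856137058861231902635314279883407721639233786807215892751256,
    86235943366936503219855431059721108840295564886089302592761389528155906467093842724503434792252391477620633,
    86233476143913798783700578755910505060639654179264451680079146126909551881235389479404025934062359297980312,
    1128412150376962293187149029726284004201010200661327523375095720773807129312006310935881275390694195930353170,
    1283437251493323586220538441812222105357249862623995703098242013152155388854342126079311917803639563594146305,
    388967926827519960373695144320790585098705766959749456143945659684888494719244842486530945873474058358901656,
    985284933632313504218843076698001103166122211155422155854015944490632525481868764677508638723679954057649170,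
    86231590539147034864997974970716034909830265526278902844414463029954842697418014618432428503066076749694360,
    388965512126766518958126217024104161254607257888453532765461734575379510772203145751555494514288826366862232,
    233007606220383181440443922307886821409005398691507781154278616035391224588717065648896173639468384439835545,
    430251986775163797156445825827603830281980369968470861212304136097425308121866380188341864381101522865795992,
    246766813098807719583752092743666827254433450581394742551250637537413994000976874037316392003525157536804761,
    1797180398455330656333940159019227521988127230855492401866532471404948177940925155238088686694770538898005400,
    1411870286800389224945550328285325796530572272282983996348956228744996954001324081191121776329970857279267736,
    160662141264436435671761940975084376382475542547278339015842333558692209970165404166465601015610055682696601,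
    246766445674527873387872686901306118469446659422478130335133026561053600935208616103409507786679825524389901,
    86231603877184695001940377177384728147450944491407647940446042181186639549535141900692334632866192417629593,
    798299108938451352434326514416892792588389269240950978551956276874679026303749552321396877751846435008483736,
    567856251915140372859594779598904388555681007292168999275548119738876896309479139885549725821564423352886681,
    375202368159892689212288240659867291098811795105747126967920247007080245166718853711233186786952630719489433,
    86230610640409530737844827460205023759850499111275986562355345947159373967128163733737980725818661666109458,
    866012174314948930473959146551002371155993371407574557799122612125018432435415702346131431947550175728701336,
    375205342779694059386811665814736746113746250418049161766710947048398074557829306221168057609909914470720921,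
    1411863742589556920714301040139745888599401049774052665202510300745873154416460258690249480946052933219263897,
    39954452992294602945846077247197872513728075144484240833097662615246439458404902006903509598354490905339289,
    907297599166435119078954681491737550162136716794558998341791160925033170477821700369939802837229544598067097,
    699207394655974504803434823703131263850469640919422307343024686344015167704142584079080201743630564478532505,
    671685411264827848411859594150630912172328704838727503363223708679384289857794590635911313367708410398751641,
    688060066145816759665157893678160990199040704611790836311394661226770813678771981105113475863745003385083613,
    1324711757528983578260703336415440732316041015720677223295942120798581970084803754172762458471674995718227354,
    90817415428568479331290740382122501147084791776608155477334208953397536676732084271586204320166483691841433,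
    1017392111954835714124464848066214679682588204286622769829811874477525579335771368704149283820169080848405400,
    1017392111954835770397785733510794151931195192185409756706190400519438104578816753342436132086085755961979101,
    700882723722322428788373350978337334785422841598956165436792140206497797783612742197281985071952153329096600,
    90818513604050390948499816183087396056106596057570503078454272317771927136654696509041513859818781765909401,
    1806349056642886850989465795731068770174304379666897017685180921201855298031542308303763343255083678039284445,
    1154997934400635177844590260985136323652932281150740972853789469816399265625056164176779055806704808078195609,
    1017394071721606092324963821611573375052981503413566103935342944329506337823187275824610491252420284510295961,
    265115396961662090485149617645899675981477927464783375557178761034804559853527348996955691159506869513656541,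
    700879854025074784090959786147814836821885986164894517358988415808425082069733253417981867633377626741024665,
    1321121572995918432084408818496009485451454870494748969258363261322427291159763986356461065003906061244414873,
    205485692818891586374679431370057649510105487154417236244622281381077922936505131911622802720684172768611335,
    1017394397802722083648574065023250469616733050143729766726313615998696297376101457610309975787539362952061849,
    444007186653721881829516279384083181113626733950256723622936828517825118759102670723102548565698446969146264,
    98313766898475271309600979238272186076861915713679507604677498020286741351549426920372770045506593342208921,
    677958183842647070130390344030909115227287689939919142240085466034037755270199607845660018960752948426083737,
    63290108498442453549942413366050979091579843568893960702934509514982572600523238297903660101253289503671704,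
    682534734799250189379046751068972970743963221497034172464059486375736423410663314703633162029039462796868505,
    370496524467257614198825156061026677079086113350300115241861436906496136745196023471863601652227456077580184,
    1017394701659693857117831550065413689068813108264432980187624479605886156758740573484207645832990868197545369,
    1232974402633129417978709592456025952283011587972745261217648420430169958794063340281393191327646728468125592,
    414813566278946058726832892153430693538245759091626550342133272241841013943193528382086945087690365511017368,
    86231275564629911625547893401933609962165323803192660919997773799741031703777162557557520222367009250327449,
    182548484420130977269659977639858178089312439999489442988004872355631368082159988709018295681390656029614488,
    86232447931018330643796507457552522770800083553745927206883644711495006516426013194607790549601873542784409,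
    650422202077849431049142981253932385722571143639494718233363288279934170839203823420154170740922869822286744,
    86235015968423981348203088351609933835880327241383700740656554372860526930426783914290245434042908601097624,
    985273000022196172546007138378211717999922129581319429979479362610192178644853388455628173361024893435839506,
    949517998464638971387307496372631487890978595547979997066382799626631750879138611386294549447284997933538834,
    1187105392664689591945785867427453992713081462902727697107702763806983097636073503153020820412743795704458241,
    1191689835227035600247778664127542270430669679522297530808224142228288368831586917065555246119490281222972825,
    179056669828469732472153163726073379430975988662739335982800935298862421345971880493784488561425791544763288,
    491048094674526383948758155911003180392444338196851090234943318989411649886438837920640969156307556231030169,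
    866020888333183926658960126369937631256389397761434132224664276439845874520887807401410109817990883846824474,
    599978478475724114877824094703216032355798692877099778977581065736015407891097348052086412465286225599024536,
    1411865702356742497772552057142238398801439373336252694471771711361419877383990248890009832669456868841742744,
    434835291961962673868048723357884439665941559216395429942391487045570808997952383464289075805256164822796184,
    329344661904509206152474881243129372204460163596168919513206208849341887424738934992681387415680087616456089,
    1118297879525135063657034446106724206576145936989625437269150969215705620375698813692985250605631202553889176,
    599975608810649715302304395232208650914985573987360766237544928872853705003456210989209565066602481467852185,
    1269666828406366765945872455832898804104599548419975521172145074148336223466191159820963997191386075649850776,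
    1801767693742541298011461157464269939317098357120437601669712009831137013304760733849063590649415304283694489,
    86232688733652818843882478137515935146513165393922957908313444516005739788993536515765193990811872118750104,
    86231568861281749548248471635805998074332639916129619251392733424716588807632119970815548980123728798311320,
    86231030592548723196486909805149332782837144284363965018998094421134445965078863654372992225784212608016914,
    833902091354970009360231892231877248427507108461971724290345153112708704983390876198886063724688195252281752,
    224928671916943802334784422664063357393123037847634582521194207537257570198007723237394798721121023659877785,
    274288131553251758017557748734667724198743782490763687633791713165713090827282827604346940680962289363330457,
    86232325444977807471132693470722544928757107269673738451505247643637436665446187446756647135125436871379353,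
    985273000031140602726642103256834973559908939878484450730920789115485183174760643034856373159726591451893656,
    535756552708504838329147083546755481374748372939047613909580399787034990908441932068504699895777962077201817,
    325842908488941572332457931580600002834674258746972909781729070968542219852675929251356058278730602402602904,
    1824693493467553622801656597283001858240662347355892894974638674649365298072324136969878819959534880666476050,
    494464681145368077627475304147434412140661181055523400693393800142194578896030226113656410007349796024624537,
    1242150164378278175720229293796213943170246505113590947082398995215920295961241509802922871780729082252656025,
    86231030592548728543706347275587155122585500016886703202651477768503762439865255002399456139380552238638489,
    329332395846165472113459283908582082009411922045681519549176489113727452038595051914922409050393579974961560,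
    233019242358028927885587064456598906581355747770112571093336106514991060529073352329201022635398888522524057,
    810968172578095475527541475318715346288776440168948218064092681165635393838005748245141639369906871314356632,
    1443984989291904144600286405682372234498358223147392687905940626653338771792499691541566177450571698576334745,
    651515197516755515563195803416105454107907387124142987877112648029798559426125195577514897351949074200562584,
    1797171510073686181993213181777540677447094947823425965315791171806074609406861655812936027856156461935633817,
    455000333388607613906663492438758799506202154165061888917431231935107579100661313541088494652660597073030040,
    687118179947091338627689313416079096416740575589052361174684348282095576987883763476203647199902310224895062,
    86231428877235332998063818754306980627864435492501702771008260317825791535278498477337554776372719420188057,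
    985273000015187463046872577452860714109606890243192383525398483880852098071472404924679791092593145497980824,
    86233353657873214754640396008253551251491132602536439037137483187869306006737426984125261538994695803774361,
    325838394055577053791293420987009816351359539940207529710697178247155184555635334726436897074825665605611928,
    86233931092064521567221669050476140534979049481956881657804406675315741256705700878083602723744150810797465,
    833902091359791893066784092880962208724791794394273716997509146504043427913162461573895514523732983006137874,
    86232115472445752872675049218358782185486853089181463234479046751017121180196865113215301297731212446830488,
    86236485818132291727768845366148296218260350461992144421489501416940822096800886385283969998271263476722584,
    1654974595900241550574937021600860230922790561151310539547401869835128086172716958997562737833609333810953746,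
    659596196560550538470778414272911252238554840783875717994944846158007485049461757080494647394061457733723545,
    86231275564629846185516552326328951010000426189058340050212091347477593662191443611719239315316183972980121,
    86232115468908232121318706980558642918885648146008229705009594080984075111749464613108034972071065483939736,
    1182513880998610549314774388997940888918777736057669533815273394137534678686792522757748120297667986442493848,
    86232902879169107917672516595130334265083524603863016870163079979244485599072499703746043923671059173221785,
    1654974595895101765311735523624733878842073314907570672792920368091920416533981096448522720983952508397707672,
    535758529979755939129205427184957337665773901841166490894431168319544024456386221550612729443869892014515609,
    86232653746385273341908135684614827444199052313875625967760005220479918775686861439925722762309807271775128,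
    177963201992118267611591176666806296263083388469931047564703360765964645675559453363015945817831532283633560,
    589054805929725831578697686032236876373539879474096340204571217762727259505120898391362588806829714104707481,
    1228387615347005665111528431496786581825634282470241866937837343912405574484376086653022641618390426872556953,
    375215684105326117466849457667703941201997379421000375789690845335077007752918396101690729591079179450098585,
    535761304645205062974399895913158771255276366334168627771639399994658832513360764084796130164796821944451992,
    95397251805595501845219264878587714479628472289728376168927997207289180973772021052232767682928115253081496,
    535763001951767469638181047655199361920408841263290018872061629616579443131780163219705707829053104398068121,
    246775444966180387671523736278146471995065659631854583754525374649876405636897146393266345195591380525989272,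
    693112349309631577076062626641348687094691548497648772616079860527617795645474954063997345860252710844285336,
    86231288893188994637830033802218409093891463035926541542599364457764978026106029263149007899154514459330613,
    659596196552874244667553848922480081158628785162059331482829271041888667824521094528536894414193445044559768,
    1182513880981856401001845514625955698582201337351244731006924630505593462704635167659492290936196044232614418,
    1182513880983458391278998919431446724457669078935095667725497906485736639799642462085435735148430904380630425,
    1031142972341997682222143534775754047780828708958183596629170401116297888088265514507945610024374236636259737,
    86235820876690753441008653003020587056567898149680908572959236485615416238451533515840735379383377744897433,
    719227160557551671628342929125478406004945800523039180668420828241398401354936491649670338760287503488719768,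
    86231061419113659982034577927665168530167152339021012588197508563791490127149191399838310806963592749917593,
    1283427820087037520373315841598472378264895445926406772470550012084998875418817074354794848654494070384942610,
    288064766465107745663921254359397817940014371889662255605925190622663205692555230936019588849865908901914009,
    246766445666600576774877029755620674429391994914486784623128649597096932623683989542675108897345559224129620,
    1210040273836555526134724606348048715526154517674412335780736079120080601190568959819823769424036120588739992,
    833903246225379709059251919346353956030647048192919458310233575427486494379170363435411356482416979646392729,
    246766568144698877208548613470889255883720669193184717832302596431831217446654164814808771975976494087592344,
    329347566573471748460596093258582077126070706950465346950662041703591444193551996556751561170132281856204696,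
    388972266300668057632904302627281609186887993495425847734566612410024551691120588609830716553561315553520024,
    888947160479255138042420589718502170193735514451700232135151179090792982302065069485237480253292530417021336,
    1755890827237024020206405088300880548042514080971993984807477229315926222174157434885759708556205267985306008,
    388975975881234833692520444413461835185968537361794105828668653390255202112202290802461612714117432485161881,
    69558996534193252669212516155460502933160404180656019997460707666547644778241802225106749094439665713617816,
    1398102750891397833795831886666272699985755284369446123797310031884832967588206481442230825254551440957942169,
    229513796862303556053489512630490862019435121667888996285854586170297042801033471108772370798329328002147737,
    86236643282963260904423844272523048633593289484841742774382788515611033765498520216324350778628175707514265,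
    86235015968424038894469419426599633509361487700463952945987574237752926977389054704978522361898685287398930,
    509318283318162125597119034003153019217228741227748196638643111473790475426626502945530342046467651925206034,
    86231061419113630445021663421112259963654154432095649538993029084557916449540625411663859966966253446243737,
    1856803961425272010539499425578803447028970476900495915723428934980083004842525126270526441723532332000116242,
    44953510712489038381378068761857586162330351197505493864437967280462885387079347045224472726891635245600327,
    1269666828413575797562302607550043737173668904581925498838954853161305435880076400943433962432505672773206424,
    32193054988093368619721887563527536213000539080297976512754044795352414958114796986745731616552729081826834,
    563284652886344136937721423590952143264632869164315994310057242560114876819904632022058515077661396815582105,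
    179602047706297725257148159262070003971600929075839231733328833230885660742391628438024806121645381024886168,
    1242145912376309575685894892095416083148442370238856148075755614569636769666632239811925739735867945641877401,
    1769656158387005332902343504151480256764141743363739624271426581156113323920433655404806985937412388068586392,
    962338013863563697695320201923652154281304163076024390486883533356895095760970357808333004589639212164361113,
    651515551601262404163771556074401398053788142321110750815471581295018350605295987969421776430638991369840025,
    86234980972412402644329635306341859882173939781312706312894461504377931840996904014499262874933184195208601,
    1787998303020037662249070833073016169721390130746564420133491707868012362679688793613311759410414819846950808,
    86232793742446586531740013420475858914699821873237509337576095930083756265962251953780232580679771344610713,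
    655009199311898811513512080878163529208704671946018445980011496954675937488162514029414355551164081637797272,
    86232793721687665720091683261569487778582300001422184342574617344755322142081851602380793215697610858309017,
    655009199322629592893621606759055473684487337342616231284683743660138605733459377538968106544839909077091736,
    86232793721687668266386652843151620932082577679800416578612986442728579441531405612257722968520815336760729,
    1191697359332452293484971711063203134585000630949742254107581849199936847787145339007521811417273632142287256,
    1443972723229555402618029796481187250756299665387397306162268119394238603953464977138546999831023433401238787,
    1191697901784582900810087737513283118768472436465842317769646278223580762100209551760004972625705721571321241,
    224925014833731988055501606187869975752045623853408053606945017031240594511337912499237108041420728273572248,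
    246766445681136083280184269251631805412968323645474740893137951749214864989795853850656130287221315890849177,
    1141235315402910521234824968311367284564552700541737982240303256528029322790810726922731222536247808224142745,
    650434818107907665562857063281875543170073456651321403618188437886690723371354135183898198628630351342345625,
    934821087378337451280115602488293670738254066787643823434636616516527024757218668930804559932023631310500248,
    960555789427596035198235656951544428531391379682503173131036519524192763859006142746490529865520845949134745,
    86237133227125570285227892644244089333648248820310303852778859688564149505850680123938179206886005087155096,
    86230204016829458721969468483584078239514620296891687910941079950597676607629603572070571836055309756226968,
    86235628423524526608641333026242798688105542505858733774267807930647117850715143875291489559262097561679378,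
    86232657907087949535142785651316386973986734290352115210448598438888424112722529590401743851585122295552920,
    86230610640409552635981572989233274897146659339726311357139211998546062330387018657520058658029055412052888,
    86231100584571857179182624600192169771748141660423980674300382330404040630552266361637601657734342872591256,
    1824693493471158144211200714707802948923711408144932257444305815075618341155074174628772688793385211728568216,
    1512778749030473588865228949681612461367935440570039231047646976312372913807462651297835378419883699972613529,
    325838394046165426608109890372195161826725307250686365188847858457164042080718211902885903835919710272382360,
    86230190688270388950606696531814048703204231623981985073583620632449949440969128184539844847897947756570009,
    669819270415666993214142077898232646852032646186961123841823943101587315481714333720766506312181621818223512,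
    1714611001742854304164719439924552691575992838569801520126900271787841939517768882037090951853892710177579530,
    289142416190324216728717184045558464694409668759762481994981967702293278154694654748998444309787131198842265,
    1242153611480681212256319731565687876314889723812647186532150667629842338828358048874310333073416103762339225,
    255956013314387426958570683237756488345201125432933178291681389772187721744160231159343754211324708165915032,
    329341063291472797703155292868581881010507241477412628232147170687775217480836291615348919219792061764352408,
    12830514231106191614100838325921482966516451065332439092866559097866318855954045049722206077854745803284888,
    67727777732119315930209744865169018977128304493325988486691802308328694103152905056828712781692445250326425,
    1797181851378877111703280841175100053867896670281473925349650207154576730470756181523424296216768465065938841,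
    159623990226347903338927538993032512475012605556322178922300254742965375514604942023396640206771043906727832,
    839440073812568589799027380631172194269403309202062205987460024316538380331473252617622232657854041685767064,
    958844926089328769522851643791585353424772526151531668919797405152358666088776729624105954715034166185521154,
    316623457803467265881894099034503851451694849250909454716437803061485148719860230485805097801994383952717209,
    329341687243523531724543379338981272667139319102383160245058822507080766723370568204398344441494806523647497,
    1820107423627811563830090220745300690251797805559916189655036274311878177049375568557019802290021173574254488,
    659596196547000280318931616379499231279106283545453195356389197025118869472771224238177303399205912325427097,
    86230204016829483930289675545037111848097523038479758593989423293587356665897142037567381412310593608623513,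
    86233843602035523686693758089830368535274242042049714860004124995596963755886258375217354532705108354170386,
    1398102750907885049423205903645036224695835998056525212736953495629053669403713537908345276258281960658839960,
    719227160575958559405600788156669456891959470049061664307383736985977862931348890563378712120932247346881945,
    86232321275531074904350456268500470862654145350100758516592262008767187409229385853079618836962239243101593,
    833902091353902015842127679229494538947713692062036926848691486964149477804343438706487271499359538995826194,
    86230190688270440894924048444141041695008469014152761435658750474832506652006180351643042504936304989447577,
    118330523183556091594006879767103839140923351491836878100637559043725563556912800970196569460102914663147416,
    1242145457452365059372066156604824660575525224383655782371772011551169076580637804583529207325989940517667346,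
    246781126452465357949457160063452277483105733372677150278727236087134807536667881968612606542523692960738201,
    499056472838212631187136770460500062826140712454754289704074586627342108832467295907636336976095250259162520,
    1200865894418803919463416812692018942729435851788700074056871291420253514143825072254622240618990276695979417,
    902707662260556857773815562520494671478790870015333218186523787113576359217809204251005234419677875224457625,
    31178135695565027223709850704925631165487249923208799958957085944434743786345591181162674874572273743092789,
    338506390314264233042138971254158816175310656483330902211219969377531225310715222036904880854363575951582617,
    86231463872112051342211072374742282426428346216225769842322180440986957360892505063504885264322839217448345,
    114838866062799955519257756919407528257464850369510175929694518892369684961267849559081381270900467904557586,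
    86231568861281780103788117304353657203106416862635830684197483461171878193678221136479368480616303195858329,
    338506390310125758160102430479157661677272196264386519083782895294883910024811006087759118800464335602036120,
    301496969456705158446745951834911114067984658308751829370696201144714109103141188548356888879771993617474969,
    4748587809758085919784372390381292438522319751810850880826351751177665135651689129439575727672177543277465,
    114836521373410041974120248075444909194459865558244553765383179847234970587267909074951301106052772485146009,
    86230623982051398373537239918488940110790965633461398985551421827504943278270284351546102407262072674985369,
    86231450544687855817197187524657884784391274153584871935854127886720833272858086739223993146987264197850520,
    1824697902925966272353183460041341238901888261806420150753653467978457763865651119678410348912909252611838872,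
    866016513820386948349440092139906061873017040196941776097266042857834955471891393274066891909505007778803853,
    233009968412819869791388842331738954836185954091070227389098165576737483904484414258723067256586897797424537,
    86234683506313800895761866459423831157691576448623695047112597161700372631358425136660527670244483287491993,
    1044906116289847751134088845605967918909528385708128610003316068561334660501993235233150787657675848062444440,
    4748587809424337945226493118689454120251146445181307171894420047554573829056469667079474228139576237562777,
    86233791106883220467139495659747049627176413692900697380073227490653016384774888372091561266795605229839769,
    1512777681701263509906111220360004179598140808896400649244714369021072261864352359689712979696336126846760466,
    659601638381280473661331023006652268037436973704775543087740782004172421995574106365204416888622493213227026,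
    962338013848427426817776304245604874348420551400283950285362515832624752883847107318865497222418002331313561,
    86233476154793778790555211988591763494219827178281607125009861646947936172121931714782327432476339118437784,
    1256998832135531160428093655893399468702075093644030411369208032219262916200519229907549727968807857758205458,
    86232688745000284347481926581569387455324230197534696934958450635553443009553960898653837461327572237297049,
    86231463873246932778993353738144559468900256074083185449210071525572568042535429561785884850710786591100824,
    866011071978430512953435538866750565000659177023823816122379596417948438374574877074092202129021176973258648,
    985273000005057416308443779673308707715661549575247706932583088018310042585000661269587073827658714834806169,
    1637953609467210916153905642893139521513112139651978009812077324754955845221235700856130837338477558371750808,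
    86232688733652830047580347799336138735138619665674632815624977156657845537327480218058536464240230100040748,
    86233476164205471667320664987083433655566303636062500371861185794010651291803123731173643391879725634028440,
    495514724166385292678701407739937040631515341288256662683452093963433904413748096250508469129808212828681234,
    866011071991847181522826382647369302792175194998953844347358255193115544953194215329411191705567976710559245,
    985278319374574217593672660610898085670137402241272098862384203189347387486459347529767306619456376319518105,
    86230623977912923491346258263413543040778316156660980778009560522927790643574274479456817935325649338639769,
    977149869751654681026536100484943875209618157258564750882167786082356777349185339366664720884559547611032082,
    170912783002899132718534336005386190693393364698499384884112348329230721562133900665708212392203468669246465,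
    86233931092064575039058599415001720704482601708990866104395806854221845422157154988173047843209570836089753,
    888948350383231796750929719159638770648691615915466220345098940483108595110597539688470911836079949466623506,
    338506390320738943744828624381379015963785286653615555101687422548184756100863774112042887176061150606470041,
    1546052873811029075706508838816561415921974752838048093788125264686753545601120915224403389485828231081239961,
    86235558431567936735774912847844982027869218197907451986481347470309534180824667882929253740405908505383969,
    289142416198734665682543092187909907932564852374400550621477189922273242823192869603637834564669514637939218,
    1801758454849894392005210811071985969727959641198599763080864640354591989803218899291812082934215247915422226,
    335012388499712710160706491119262958437282587436776721819424515214382174485974780169781959749414364735741336,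
    509318283328241393611806147917156039467262662119070458080364085299037869973011232075779312015631551603680665,
    1338474079125896510765005717178160178015720183221072647858811356500405567904422680931412337462364736155821465,
    687128451231505921364162813596747199806272656470665844441093546110821316513454333406839743490274314911034265,
    118330523181286605368720472918417208113146476552584865295278768213995644101859716976744725154225915544554392,
    289142416190791463892757860537972870706666893218625646089433582215819460434524975240888538013225189382301081,
    86231463873247002232172611655085540617851397976265056640476997836335977223230975111987489640641161278268825,
    118330523170339671809495651056781027736775457701764609302045201620740561044973504514149492219473022318600088,
    86232846215705014424438903148474798705003137373084927107087966391725074826713951049308887107053399771719065,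
    86232115468908166172278972347511332309179985928641789807355687273584241334370719038786623651756153420199954,
    86231450544687881534776389792452537201059435767408027265562104273292060787018957292131340977267980661497752,
    1567821648475245954494516304059249702991275618693725963380354100700891200548417642904451579305169165387957144,
    687123499287120790234155992514053699755179733810625811856652958660399887760450380612417183569370974748257298,
    86235050964435570553174203721554735765499307707065452923024635856522194462596483706786151281920634213377433,
    86235820885434759143060980937647909206764234870371831476834454316220678536218778922453888698648481327494040,
    1512777681703517082807257494641814156937515955437476682650084939773685052213670695261239934578849082872545688,
    86230623981717650399080378213843537641798567833072575542723886136028850614334994144535153054486069422597529,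
    86236643282963212585492841537307081027734166155678228268775073573677212128735625549506827079927272833311250,
    86231275564629915445053485768094404104852919822205329319583740522202973205942582376091759827406962995635608,
    86236153351549979260088911899315999970190208003060889098277677959946461503613141736789254599770801061922200,
    114836521387627705682175700048408660475130329557973745180890175926934649460113276036253444193093321102797720,
    687121522023345567161418415104758328188214367991878437772637441746654962031627053354668864394677640910896658,
    114836521373143043594767092472051869565738627975032088976660802528931240041859480572348287610984833328096665,
    77068356792341924029327943451214312495660771593906027828096022658999830619555760260614649434594665258574354,
    86231030592548752224249573349698901780945148892560973040958156566474325461376282409577001528957242949346200,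
    118333952736956835193116708610609542491488736710013615873435560119453102034975915176683424396387905488104344,
    1774236523925917987967003870544997572561281498522389359965015904035417591744433126990372160405537407334098329,
    224924454932189343297067853645667814995629248787028867310081850697621736252273947741464781742804289632871833,
    1770596627312073315094344825606071214740050876102148141007790556167133175072193354660913785873298384249431449,
    1443974875424794838139614454886947990145165004389731002266745813050273033261640308342022118237188739328059393,
    985273000014987200767621118995002210067025335479660014554489659447918863799612951090019155015302003265183640,
    1746715607899708416443907078176592022847449017098664834805223836068908050573147920116682696976057872259491225,
    86231450544687884845210452655111806994142415730371992670858879115337839879183632336820775850355598915837849,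
    1801758507322271068962644512603381514346762672132210133588925173937238388359874049348453471870750744809446808,
    1714605559912645863675387624195437298626098297720504459445785739651068180133816379772399786200009634631656857,
    86232916207728241601173086901802431187607431480910504664738316249288388693070125307280746286078124634940825,
    118330523163346869524558034732107725726095256651364935761248142992525178354731107195431190638772520887969688,
    1179019879196674699864445021438269032694112110333550183214151785029919806420667601793867255340048962245948946,
    86232688733652805093889638653272130732432861583204313126140544315389122506383996121961593983008512522855833,
    1182514248405335250656034726905651089277735762878332201663425728888382211961856158729870513150485576114766354,
    118330523160861293503500396160786547896546138850552332979409636414050442217684129485296126448683751978313113,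
    559775252882225624309056672568811988457075269702632467392910763855606607519601960525961508457941559841138073,
    1182513881000946785135388879938141680349252144344910600399640678007513649951954420061530794042596187453793689,
    1242147137201714971207556688480465902400349076881751485052343451356146704409232147475985174053459338475873689,
    86233476143913759316128537275242583605190849781027005608978009276150123897980462428893877080764868588995480,
    182548484425671127949854386374446034286150544374819188996463673958906658427979474377424369960838451786173970,
    1388928756427504297344439857126222722557687599962991055886969514463875734185845435030601498373134056616371609,
    1806346606920873565660461896448630497139248534109466743196352217918925446049682368129032674747561482632832409,
    86232321275531053576146139598388641367371384773558895116150086980010496102651831541914465263232177838007193,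
    86234106072122486189797315308349189787073010757035532726209246552875104326859044091593147337524116923109272,
    86235680892644385661569280139021791572819053572508467726089748211136506274926711566514768788566508000547736,
    1187107090020045932285413851482578823485829146534876872245411609016597292826379020284754654474442083905399704,
    1443979214930232826223225695332298384133422232640418503536499003050386121459473994463241233992892212464511897,
    559775252877619975086095757351598020159045985368231072342643364332462594490417096526451689280678447248582041,
    86232688733652878681814282925991886760211388022161032433219754625186503241758295576325457591709138384070041,
    1443972723218007722705093800910810248646967738007158427685009482851632036570206653877017172353933035673286552,
    1696257570966118137196606473417802457446535528715304502177689581364107676050723419061141109698187775038203289,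
    1801758507300726850666420285071711334387582710100603646993795742738839415185703285275336596330033404320949657,
    801793110746127667043772005927938363831442614364925436761014033221962690789587260826854581794600187806968728,
    86234980972412381061443369534330051249371398492281895750429983156357352303172035873536243713670306915689881,
    86232846215705040142176432827236234984561830649858378704370793404406384705644952665693559502529665662209944,
    86237133227125605678727981455939838252354650508893361911377840317193557478966164996645157484602489079167384,
    86231275564629917227146227295369651782271263270673663753287271383638859886893479068781159096573822843163032,
    86230868941049825350170099131618705124481917933971882824483066439133397273476620602928719700065511400479640,
    86236643282963276691452661239913164298110791729453655687637378896357732242957098031832161314522534815131544,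
    86234980972412383607538248317234662988943003436221190933388661930007635192618195081574357676728017223974418,
    1453162168374563490566628447256577628270189277541111863285226782097593462562214745948873288222250071621034904,
    559776026915816889320745826305970161894293606706044355191125539778077517164792015070684093477832447603614616,
    1031142972327446175563968197950774670739868440364153527151289559812998791852692565308679547452787260909489049,
    118330523185425145944367843836740206686027159393641916744580277128896140752607979807617253424787037341361561,
    86236993250755375360589645861554826501242210636104025432990803708194219072776942760531373466292172842167193,
    8242589607221712513899110823261558966991376503902016952833075347140876560940209919211295237732945992466840,
    1182520512691411041424401987707071215787118590595787189604367513054810017838994836510815454201063727211488665,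
    86231030592548705627051614679802944122200695633801509876322679517110028660903308638264001028461414481667481,
    86236940749061875954207541243183994416136791271785358648503759003547296777791309179421455645927869491053464,
    224924454956619629326651875326710698590817286259881200328741253722970783819991450717246850444328606225473432,
    1787997515604786425926267871664012229734830906689405482897901838740902622381733574680376507887354081744027154,
    1278840822877869756212916308710599582724932824875466884949710481707921117814955280452128095623221055075002776,
    86231030592548757571469011227724878241977628380586965250967344721086816926940353830950032658453643200570777,
    86233231170697676015921960894126164456177793744920514293840667785311539684034275770239522459533574444093336,
    86232688733652898543073377729828098415181560632172487670677761848484474505088271909763710228778689556212632,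
    1797177161888425503746759869467343322933676439074741711829075960853773604415037750410950043320670051686090136,
    86235820894045456881654060491232471864949774785881303727121703815417989824432546180995809818586322313817496,
    833902091363647532573376980916051304300884167972904891381036013476826976553548726397119810882068698651447192,
    86231463873246936089176814633248749927286046406003100864371622987020565338948639031286018786051973332870553,
    86232338773536898886183377485018166692873705004716176677647171566935734273948127890162359003388270136632216,
    559775781941717486108646615774892739333384085048480699618569261312430680647047045384266027489383857693023640,
    1398102750891464583390995815503180162592159218043305907373082083241449896316539476861820860150990109023413657,
    866011071978430512953677401143832668249876628341616691552724759509176569957466210750857430063625371195024793,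
    1801758507299175709136900229902881749375445822130958744973436651012832758341629052942897755175928884590290329,
    86231275564629933014175043909868901488309913751372746184577232242815117980953008301513021179971257877144985,
    86235050964435629821113356885804157259978326125757526477717984397963459194794322445802717956638411585687960,
    719227160576292350666202804637918546054956778845885167091451657165786343621509448240407314677273599691481618,
    86235015985778776454927138516133176274311425466589359455934147270340845277358904315089044445029798810494361,
    86233353657873151158069726589960657068285066616784533536761687146993840690300037345638568034137919896061336,
    289142416178309289651447399408167665854083526071660034807534116603162802476699453055777336923606239882285976,
    292636417996799038630323351869948159216703193626301956547646862655170170062747589844419042526381323776793618,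
    985273000015187449552369834465452004948350590157824019587767916109732762362362899827041072468444558319953305,
    289142416198534416897883740850062160702427715069316892970777305636488171832853514728040350606958247951738265,
    338506390304000700608616473526098275974202939681199646249640496852656359511494671173400674580323013490648473,
    1696262085414485497315039260506196540506986776897714979104804029012308264107410468864180186111562745492022681,
    1278841190276918272477032647683481895680849170636242705991171062716096442473890818315304798203673607676110233,
    86230623968968651435241048285344073752510391655103146784776601928294653734983048268839762270399816810898841,
    833905065977708338028432619986752448535112306924589084315040956894534223622152104894140072466796404300603922,
    86231030592548703844645134049500174146126063918563345545049136038015861646761852249636325108006325315446169,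
    86237045737096623524912899742378312162387269995581603767896646500441348524413981283870364990149686150455704,
    86232338784884138788129301103724459847442730705437075968197141974694489831252407898210340253124709545570200,
    559775252891236819616559525648420758991592695074615810476216773917862205302441689924099437149395648449548184,
    86230623975977185240042932430409446245993279994680424038372018679998179803773023126420779197641532953863577,
    86232688733652811204997567534455639428573238286906538801301076227661648813758571302536970641418341549678488,
    224924454956619629326621763958885973956463049541997051108943722883072016645114637518588005847065542261005842,
    86236643295712253247896251402973002828396703561022087739048592762770909339125411783218712982651519620883865,
    1787997515609659146351807034278095312820912918420126268671179878815758743371504383401509977652284168643842968,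
    338506390310793254108620080759224746463125957197822631698095846484519095225608185698251198520685896663500184,
    1788003727360650765716182183832055768240340027397229800817218347395093473650283348048294987181194977887659417,
    1430211731521066049712440025051377328899704636624390159996282510928793145774024811842662464476421596612196248,
    563269254681157741990183686001616949481835975439560467492184858386375931129523053051177769417224438715786649,
    563269254665471637101903896115967397376890530921828581931738624122835280004036889845198136626137931785971097,
    86236940749061789186524567831274579822155883541999486587505403365022352887837601514241108204565106083767705,
    962343455691969913193859105133486982491811699765985693523714809200109863734075344915079008058967395748040600,
    86230190688270379783810761400101665332083083543946911705640422445687290027558041752830720964615534293296537,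
    86235505937150044374291439603463267923809653203434138356669094221968812588991153557751203596634888098303896,
    86232902888062547523574242079007227376107118024131580337114589792398717788697202530357349650670362453900818,
    118330523174494051868383929421061878730175744773599303218246397495302120830670782183546618645712328758133656,
    86232671235647040186258356565460124502950758805960516403654840521595349037987148802661476549712925474266520,
    866011071978430512953514216956884081508619769297606365001379726343102086406934840646345750627749826423791000,
    862519401547004201588442520948907825445417606275868646216014991330572476031761321501592600759663837333955993,
    86233476154793778790780764563459353610308232355906335478950342337550310489407692045274966659655473442692114,
    1774236523910498874837716373132460859171275319749102843923949147341029022046501617906766734314712613280747928,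
    1774236523909831335602516882829437136831944206320424028676805693117640692441632315640324548120439785167267225,
    1031142972341997592593063996749700175097960575716589040242067655955257731984998078372965562464989646363305369,
    86232688733652853218864579377646668909292279189458969664687619703710977158313013799001771016656816768558489,
    651515197518958252194032950862227541681675149161327552168316717225332415151719631456768475260326999050452888,
    1165776080199808391151790669847758989145782522134491863781118322779099939702633253494855799666694795558921625,
    228418456740866836136046779823864917798191605228084147514619012751894639886601365151102007952923879135850007,
    567856251909800446773769896710931179591970269893712571313417748129619089600808347620856604986560112035374489,
    86232657913244638436309632804311110315810902820776453729806940581996056701228408373432216493289588012885401,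
    86233931092064532516234675784909106415473446733104126048326407309962573065367619197162817816190247208423832,
    567856251902991946592939100886970344407149747785110012311598835058245869204062036128323865473537579696808466,
    509318283337920005679076624486660094807923250211635914926968353719812346638194401509349921435246668917253529,
    715735490125657797614768886404755909337704409026594051734836608442940070832426455905078571309331741008733593,
    95415750755559370102575986535276848531538901141981435056173397360137229648803078344129672203255803315579410,
    830410490918119068278610484295415097798497891447301210495229823692892701275891952013508676679533136689288728,
    86236940749328952303153858119870527433768923079234924996806726751763102766171148963776697300141714734423058,
    86234683517193859012804529345588570195606057942164505880802857860895636636414743281901661811366679716133272,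
    86232115475916731805815351133977131761885269482170134239704387033347498200419413918901574181555819715608984,
    252401734887271355205674794804854119529598257412122120255825982161491124990346951418591587805452712949374872,
    1398102750909019726842466909905080654644349762541398036468836383331707583566154899362679260124332686320083457,
    224924454956285954175676537913115418099159240312603012630166945812538596507060863536633289676966760911218073,
    1254826647237476918938984215510253407406224852506052655851267865600501933351043081041469174510610]

/-- Binary trees storing `2 ^ d` numbers. -/
inductive Tree
  | leaf (x : ℕ)
  | node (l r : Tree)

/-- The number of index `n`, the binary digits of `n` giving the path from the root. -/
noncomputable def Tree.get (t : Tree) : ℕ → ℕ :=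
  Tree.rec (fun x _ => x) (fun _ _ l r n =>
    Nat.rec (l (Nat.div n 2)) (fun _ _ => r (Nat.div n 2)) (Nat.mod n 2)) t

/-- Evaluate a tree of depth `d` storing the values of `f` at `o, o + s, o + 2 * s, …`. -/
def withTree {α : Type} (f : ℕ → ℕ) : ℕ → ℕ → ℕ → (Tree → α) → α
  | 0, _, o, k => force (f o) fun x => k (.leaf x)
  | d + 1, s, o, k => withTree f d (2 * s) o fun l =>
      withTree f d (2 * s) (o + s) fun r => k (.node l r)

lemma exists_withTree {α : Type} (f : ℕ → ℕ) (d : ℕ) : ∀ s o : ℕ, ∃ t : Tree,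
    (∀ n < 2 ^ d, t.get n = f (o + s * n)) ∧ ∀ k : Tree → α, withTree f d s o k = k t := by
  induction d with
  | zero =>
    refine fun s o => ⟨.leaf (f o), fun n hn => ?_, fun k => by rw [withTree, force_eq]⟩
    obtain rfl : n = 0 := by simpa using hn
    rfl
  | succ d ih =>
    intro s o
    obtain ⟨l, hl, hl'⟩ := ih (2 * s) o
    obtain ⟨r, hr, hr'⟩ := ih (2 * s) (o + s)
    refine ⟨.node l r, fun n hn => ?_, fun k => by rw [withTree, hl', hr']⟩
    change Nat.rec (motive := fun _ => ℕ) (l.get (n / 2)) (fun _ _ => r.get (n / 2)) (n % 2) = _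
    have e := Nat.div_add_mod n 2
    rw [pow_succ] at hn
    rcases Nat.mod_two_eq_zero_or_one n with h | h <;> rw [h] at e ⊢
    · refine (hl _ (by omega)).trans (congrArg f ?_)
      nth_rw 2 [← e]
      ring
    · refine (hr _ (by omega)).trans (congrArg f ?_)
      nth_rw 2 [← e]
      ring

/-- The set of words neither orthogonal nor equal to the word of number `a`. -/
def neighbours (F : ℕ) (pl : List ℕ) (a : ℕ) : ℕ := (dist F pl (W a) >>> 3 &&& F) <<< 64

/-- The words of number less than 408 which are orthogonal or equal to the word of number 0. -/
def startSet (F n : ℕ) : ℕ := remove ((F ^^^ F >>> 2448 <<< 2448) <<< 64) n 0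

lemma search_steps : withPlanes (fun F pl => withTree (neighbours F pl) 9 1 0 fun nb =>
    forceList ((List.range 36).map fun i => W (secondRow i)) fun ms =>
      force (startSet F (nb.get 0)) fun P => force (comb 256) fun M =>
        search M nb.get (leafOK ms) (steps.foldr (fun c l => chunk l 20 c) []) [P]) = true := by
  decide +kernel

/-- A map permuting the coordinates and changing signs. -/
def SignedPerm (A : (idx → ℤ) → idx → ℤ) : Prop :=
  ∃ (τ : Equiv.Perm idx) (s : idx → ℤ), (∀ j, s j = 1 ∨ s j = -1) ∧ ∀ f j, A f j = s j * f (τ j)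

lemma mul_self_of_sign {s : ℤ} (h : s = 1 ∨ s = -1) : s * s = 1 := by
  rcases h with rfl | rfl <;> rfl

namespace SignedPerm

lemma refl : SignedPerm fun f => f :=
  ⟨Equiv.refl _, fun _ => 1, fun _ => Or.inl rfl, fun f j => by simp⟩

variable {A B : (idx → ℤ) → idx → ℤ}

lemma comp (hA : SignedPerm A) (hB : SignedPerm B) : SignedPerm fun f => A (B f) := by
  obtain ⟨τ, s, hs, h⟩ := hA
  obtain ⟨τ', s', hs', h'⟩ := hB
  refine ⟨τ.trans τ', fun j => s j * s' (τ j), fun j => ?_, fun f j => ?_⟩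
  · rcases hs j with e | e <;> rcases hs' (τ j) with e' | e' <;> simp [e, e']
  · simp only [h, h', Equiv.trans_apply]
    ring

lemma map_neg (hA : SignedPerm A) (f : idx → ℤ) : A (-f) = - A f := by
  obtain ⟨τ, s, hs, h⟩ := hA
  funext j
  simp [h]

lemma dotProduct (hA : SignedPerm A) (f f' : idx → ℤ) : A f ⬝ᵥ A f' = f ⬝ᵥ f' := by
  obtain ⟨τ, s, hs, h⟩ := hA
  refine Eq.trans ?_ (Equiv.sum_comp τ fun j => f j * f' j)
  refine Finset.sum_congr rfl fun j _ => ?_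
  rw [h, h, mul_mul_mul_comm, mul_self_of_sign (hs j), one_mul]

lemma of_act {g : ℕ × ℕ}
    (h : ∀ n < 36, ∃ j < 36, fld g.1 j = n) : SignedPerm (act g) := by
  have hs : Function.Surjective fun j => unpos (fld g.1 (pos j)) := by
    intro i
    obtain ⟨j, hj, e⟩ := h (pos i) (pos_lt i)
    refine ⟨unpos j, ?_⟩
    simp only [pos_unpos j hj, e, unpos_pos]
  refine ⟨Equiv.ofBijective _ (Finite.injective_iff_bijective.1
    (Finite.injective_iff_surjective.2 hs)), fun j => sg g.2 (pos j), fun j => sg_eq_or _ _, ?_⟩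
  intro f j
  simp [act]

end SignedPerm

lemma isHadamard36_iff {M : Matrix idx idx ℤ} : IsHadamard36 M ↔
    (∀ i j, M i j = 1 ∨ M i j = -1) ∧ ∀ i j, i ≠ j → M i ⬝ᵥ M j = 0 := by
  refine and_congr_right fun h1 => ⟨fun h i j hij => ?_, fun h => ?_⟩
  · have := congrFun (congrFun h i) j
    rwa [Matrix.smul_apply, Matrix.one_apply_ne hij, smul_zero] at this
  · ext i j
    rw [Matrix.smul_apply]
    change M i ⬝ᵥ M j = _
    by_cases hij : i = j
    · subst hij
      rw [Matrix.one_apply_eq, dotProduct]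
      simp only [mul_self_of_sign (h1 i _)]
      simp
    · rw [h i j hij, Matrix.one_apply_ne hij, smul_zero]

lemma dotProduct_self {f : idx → ℤ} (hf : ∀ j, f j = 1 ∨ f j = -1) : f ⬝ᵥ f = 36 := by
  rw [dotProduct]
  simp only [mul_self_of_sign (hf _)]
  simp

namespace SignedPerm

variable {A : (idx → ℤ) → idx → ℤ}

lemma isHadamard36 (hA : SignedPerm A) {M : Matrix idx idx ℤ} (hM : IsHadamard36 M) :
    IsHadamard36 fun i => A (M i) := by
  rw [isHadamard36_iff] at hM
  refine isHadamard36_iff.2 ⟨fun i j => ?_, fun i j hij => ?_⟩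
  · obtain ⟨τ, s, hs, h⟩ := hA
    rcases hs j with e | e <;> rcases hM.1 i (τ j) with e' | e' <;> simp [h, e, e']
  · exact (hA.dotProduct _ _).trans (hM.2 i j hij)

/-- Two Hadamard matrices are equivalent if, up to sign, the images of the rows of the first one
under a signed permutation are rows of the second one. -/
lemma hadEquiv (hA : SignedPerm A) {M N : Matrix idx idx ℤ} (hM : IsHadamard36 M)
    (h : ∀ i, ∃ k, A (M i) = N k ∨ A (M i) = - N k) : HadEquiv M N := by
  have h' : ∀ i, ∃ k, ∃ ε : ℤ, (ε = 1 ∨ ε = -1) ∧ ∀ j, N k j = ε * A (M i) j := by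
    intro i
    obtain ⟨k, e | e⟩ := h i
    · exact ⟨k, 1, Or.inl rfl, fun j => by rw [e, one_mul]⟩
    · exact ⟨k, -1, Or.inr rfl, fun j => by simp [e]⟩
  choose σ ε hε hσ using h'
  obtain ⟨hM1, hM2⟩ := isHadamard36_iff.1 (hA.isHadamard36 hM)
  have hinj : Function.Injective σ := by
    intro i i' e
    by_contra hne
    have h1 : N (σ i) ⬝ᵥ N (σ i') = 0 := by
      have e1 : N (σ i) = ε i • A (M i) := funext (hσ i)
      have e2 : N (σ i') = ε i' • A (M i') := funext (hσ i')
      rw [e1, e2, smul_dotProduct, dotProduct_smul, hM2 i i' hne, smul_zero, smul_zero]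
    rw [← e, dotProduct_self fun j => ?_] at h1
    · norm_num at h1
    · rw [hσ]
      rcases hε i with e | e <;> rcases hM1 i j with e' | e' <;> simp [e, e']
  obtain ⟨σ', rfl⟩ : ∃ σ' : Equiv.Perm idx, ⇑σ' = σ :=
    ⟨Equiv.ofBijective σ (Finite.injective_iff_bijective.1 hinj), rfl⟩
  obtain ⟨τ, s, hs, hA⟩ := hA
  have h0 : ∀ x : ℤ, x = 1 ∨ x = -1 → x ≠ 0 := by
    rintro x (rfl | rfl) <;> norm_num
  refine ⟨.of fun k i => if σ' i = k then ε i else 0, .of fun i j => if i = τ j then s j else 0,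
    ⟨fun k i => ?_, fun k => ⟨σ'.symm k, ?_, ?_⟩, fun i => ⟨σ' i, ?_, ?_⟩⟩,
    ⟨fun k i => ?_, fun k => ⟨τ.symm k, ?_, ?_⟩, fun i => ⟨τ i, ?_, ?_⟩⟩, ?_⟩
  · rw [Matrix.of_apply]
    split_ifs
    · exact Or.inr (hε i)
    · exact Or.inl rfl
  · simpa using h0 _ (hε _)
  · intro i hi
    rw [Matrix.of_apply, ite_ne_right_iff] at hi
    rw [← hi.1, Equiv.symm_apply_apply]
  · simpa using h0 _ (hε _)
  · intro k hk
    rw [Matrix.of_apply, ite_ne_right_iff] at hk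
    exact hk.1.symm
  · rw [Matrix.of_apply]
    split_ifs
    · exact Or.inr (hs i)
    · exact Or.inl rfl
  · simpa using h0 _ (hs _)
  · intro i hi
    rw [Matrix.of_apply, ite_ne_right_iff] at hi
    rw [hi.1, Equiv.symm_apply_apply]
  · simpa using h0 _ (hs _)
  · intro k hk
    rw [Matrix.of_apply, ite_ne_right_iff] at hk
    exact hk.1
  · ext k j
    obtain ⟨i, rfl⟩ := σ'.surjective k
    rw [hσ, hA]
    simp [Matrix.mul_apply]
    ring

end SignedPerm

lemma sum_dotProduct_sq {M : Matrix idx idx ℤ} (hM : IsHadamard36 M) (f : idx → ℤ) :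
    ∑ i, (f ⬝ᵥ M i) ^ 2 = 36 * (f ⬝ᵥ f) := by
  have h1 : Mᵀ * M = (36 : ℤ) • (1 : Matrix idx idx ℤ) := by
    let c : Matrix idx idx ℤ →+* Matrix idx idx ℚ := (Int.castRingHom ℚ).mapMatrix
    have hc : Function.Injective c := Matrix.map_injective Int.cast_injective
    have h36 : c ((36 : ℤ) • 1) = (36 : ℚ) • 1 := by
      rw [map_zsmul, map_one]
      norm_num [← Int.cast_smul_eq_zsmul ℚ]
    apply hc
    have h := congrArg c hM.2
    rw [map_mul, h36] at h
    rw [map_mul, h36]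
    have h2 : c M * ((36 : ℚ)⁻¹ • c Mᵀ) = 1 := by
      rw [Matrix.mul_smul, h, smul_smul]
      norm_num
    rw [mul_eq_one_comm, Matrix.smul_mul] at h2
    rw [← h2, smul_smul]
    norm_num
  have h2 : ∑ i, (f ⬝ᵥ M i) ^ 2 = (M *ᵥ f) ⬝ᵥ (M *ᵥ f) :=
    Finset.sum_congr rfl fun i _ => by
      rw [sq, Matrix.mulVec, dotProduct_comm]
  rw [h2, Matrix.dotProduct_mulVec, Matrix.vecMul_mulVec, h1, Matrix.vecMul_smul, Matrix.vecMul_one,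
    smul_dotProduct, smul_eq_mul]

lemma vec_eq_or (x : ℕ) (j : idx) : vec x j = 1 ∨ vec x j = -1 := sg_eq_or x (pos j)

lemma vec_eq_of_ham {w x : ℕ} (h : ham w x 36 = 0) : vec w = vec x := by
  rw [ham_eq_sum, Finset.sum_eq_zero_iff] at h
  funext j
  have := h (pos j) (Finset.mem_range.2 (pos_lt j))
  rw [bitDiff_eq] at this
  unfold vec sg
  revert this
  cases w.testBit (pos j) <;> cases x.testBit (pos j) <;> simp

lemma isHadamard36_of_ham {M : Matrix idx idx ℤ} (w : ℕ → ℕ) (hM : ∀ i, M i = vec (w (pos i)))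
    (h : ∀ i < 36, ∀ j < i, ham (w i) (w j) 36 = 18) : IsHadamard36 M := by
  have h0 : ∀ i j, pos j < pos i → M i ⬝ᵥ M j = 0 := fun i j hij => by
    rw [hM, hM, vec_dotProduct, h _ (pos_lt i) _ hij]
    rfl
  refine isHadamard36_iff.2 ⟨fun i j => hM i ▸ vec_eq_or _ _, fun i j hij => ?_⟩
  rcases lt_trichotomy (pos j) (pos i) with h1 | h1 | h1
  · exact h0 i j h1
  · exact absurd (pos_injective h1).symm hij
  · rw [dotProduct_comm]
    exact h0 j i h1

lemma isHadamard36_Hmat : IsHadamard36 (Hmat (ZMod 17)) :=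
  isHadamard36_of_ham (fun n => W (408 + n)) Hmat_row (by decide +kernel)

/-- The second Hadamard matrix. -/
def secondMat : Matrix idx idx ℤ := fun i => vec (W (secondRow (pos i)))

lemma isHadamard36_secondMat : IsHadamard36 secondMat :=
  isHadamard36_of_ham (fun n => W (secondRow n)) (fun _ => rfl) (by decide +kernel)

lemma secondRow_lt : ∀ i < 36, secondRow i < 408 := by decide +kernel

lemma red_secondMat_mem (i : idx) : red (secondMat i) ∈ Lcode (ZMod 17) :=
  red_W_mem (secondRow_lt _ (pos_lt i))

lemma testBit_shiftLeft_and (x y n : ℕ) :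
    ((x >>> 3 &&& y) <<< 64).testBit (64 + n) = (x.testBit (n + 3) && y.testBit n) := by
  rw [Nat.testBit_shiftLeft, Nat.add_sub_cancel_left, Nat.testBit_and, Nat.testBit_shiftRight,
    Nat.add_comm 3]
  simp

lemma testBit_neighbours (a : ℕ) {b : ℕ} (hb : b < 444) :
    (neighbours ones ((List.range 36).map plane) a).testBit (64 + 6 * b) =
      (ham (W a) (W b) 36).testBit 3 := by
  have h1 := testBit_ones hb
  have h2 := testBit_dist (W a) hb (show 3 < 6 by norm_num)
  delta neighbours
  generalize dist ones ((List.range 36).map plane) (W a) = x at h2 ⊢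
  generalize ones = y at h1 ⊢
  rw [testBit_shiftLeft_and, h1, h2, Bool.and_true]

/-- The fields of `t` permute `{0, …, 35}`. -/
def FldPerm (t : ℕ) : Prop := (∀ j < 36, fld t j < 36) ∧ ∀ n < 36, ∃ j < 36, fld t j = n

instance (t : ℕ) : Decidable (FldPerm t) := by
  unfold FldPerm
  infer_instance

lemma fldPerm_leafGens : ∀ g ∈ gen 0 :: leafGens, FldPerm g.1 := by
  have h : ((gen 0 :: leafGens).all fun g => decide (FldPerm g.1)) = true := by
    decide +kernel
  exact fun g hg => of_decide_eq_true (List.all_eq_true.1 h g hg)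

lemma surjective_gen : ∀ i < 3, ∀ n < 36, ∃ j < 36, fld (gen i).1 j = n := by
  decide +kernel

/-- A clique containing the word of number 0 is equivalent to a set of rows of the second matrix. -/
lemma exists_signedPerm_of_clique {S : Finset ℕ} (hlt : ∀ n ∈ S, n < 408) (h0 : 0 ∈ S)
    (hcl : ∀ a ∈ S, ∀ b ∈ S, (ham (W a) (W b) 36).testBit 3 = false)
    (hmax : ∀ b < 408, b ∉ S → 9 ≤ #{n ∈ S | (ham (W b) (W n) 36).testBit 3 = true}) :
    ∃ A, SignedPerm A ∧
      ∀ n ∈ S, ∃ i, A (vec (W n)) = secondMat i ∨ A (vec (W n)) = - secondMat i := by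
  have hs := search_steps
  rw [withPlanes_eq] at hs
  obtain ⟨t, ht, ht'⟩ := exists_withTree (neighbours ones ((List.range 36).map plane)) 9 1 0
  rw [ht', forceList_eq, force_eq, force_eq] at hs
  have hnb : ∀ a < 408, ∀ b < 408, (t.get a).testBit (64 + 6 * b) =
      (ham (W a) (W b) 36).testBit 3 := fun a ha b hb => by
    rw [ht a (by omega), Nat.zero_add, Nat.one_mul, testBit_neighbours a (by omega)]
  obtain ⟨a, P, hl, hP⟩ := search_sound hlt
    (fun a ha b hb => (hnb a (hlt a ha) b (hlt b hb)).trans (hcl a ha b hb))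
    (fun b hb hbS => by
      refine (hmax b hb hbS).trans_eq (congrArg Finset.card (Finset.filter_congr fun n hn => ?_))
      rw [hnb b hb n (hlt n hn)])
    _ _ hs ⟨_, List.mem_singleton_self _, by
      refine Contains.remove (nb := t.get) (a := 0) (fun n hn => ?_) 0 fun b hb =>
        (hnb 0 (by norm_num) b (hlt b hb)).trans (hcl 0 h0 b hb)
      have := hlt n hn
      have e : 64 + 6 * n - 64 = 6 * n := by omega
      rw [Nat.testBit_shiftLeft, e, Nat.testBit_xor, Nat.testBit_shiftLeft,
        testBit_ones (show n < 444 by omega), decide_eq_false (show ¬ 2448 ≤ 6 * n by omega)]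
      simp⟩
  have hg : leafGens.getD a (gen 0) ∈ gen 0 :: leafGens := by
    rw [List.getD_eq_getElem?_getD]
    cases e : leafGens[a]? with
    | none => exact List.mem_cons_self
    | some g => exact List.mem_cons_of_mem _ (List.mem_of_getElem? e)
  obtain ⟨hg1, hg2⟩ := fldPerm_leafGens _ hg
  refine ⟨_, SignedPerm.of_act hg2, fun n hn => ?_⟩
  have h := allBits_spec hl (i := 6 * n) (by rw [Nat.testBit_shiftRight, hP n hn])
  have hm : ∀ w, ((List.range 36).map fun i => W (secondRow i)).any (Nat.beq w) = true →
      ∃ i, vec w = secondMat i := by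
    intro w hw
    rw [List.any_map, List.any_eq_true] at hw
    obtain ⟨i, hi, e⟩ := hw
    refine ⟨unpos i, ?_⟩
    rw [secondMat, pos_unpos i (List.mem_range.1 hi), Nat.eq_of_beq_eq_true e]
  rw [force_eq, force_eq, Bool.or_eq_true, Nat.mul_div_cancel_left n (by norm_num)] at h
  rw [← vec_actw _ hg1]
  rcases h with h | h
  · obtain ⟨i, hi⟩ := hm _ h
    exact ⟨i, Or.inl hi⟩
  · obtain ⟨i, hi⟩ := hm _ h
    rw [vec_compl (actw_lt _ _ _)] at hi
    exact ⟨i, Or.inr (by rw [← hi, neg_neg])⟩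

/-- The automorphism group of `L(17)` is transitive on the words which are not rows of `H`. -/
lemma exists_signedPerm_word {k : ℕ} (hk : k < 408) : ∃ A, SignedPerm A ∧
    (∀ f, red f ∈ Lcode (ZMod 17) → red (A f) ∈ Lcode (ZMod 17)) ∧
    (A (vec (W k)) = vec (W 0) ∨ A (vec (W k)) = - vec (W 0)) := by
  induction k using Nat.strong_induction_on with
  | _ k ih =>
    rcases eq_or_ne k 0 with rfl | h0
    · exact ⟨_, SignedPerm.refl, fun f hf => hf, Or.inl rfl⟩
    · obtain ⟨i, hi, p, hp, h⟩ := exists_parent hk h0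
      obtain ⟨A, hA, hL, hAp⟩ := ih p hp (hp.trans hk)
      refine ⟨_, hA.comp (SignedPerm.of_act (surjective_gen i hi)), fun f hf => hL _ ?_, ?_⟩
      · rw [red_act]
        exact act_mem hi hf
      · rcases h with h | h
        · rwa [h]
        · rw [h, hA.map_neg, neg_eq_iff_eq_neg, neg_inj]
          exact hAp.symm


lemma dotProduct_eq_or {f f' v v' : idx → ℤ} (hf : f = v ∨ f = -v) (hf' : f' = v' ∨ f' = -v') :
    f ⬝ᵥ f' = v ⬝ᵥ v' ∨ f ⬝ᵥ f' = -(v ⬝ᵥ v') := by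
  rcases hf with rfl | rfl <;> rcases hf' with rfl | rfl <;> simp

/-- A Hadamard matrix cannot have both a row of `H` and another word of the code among its rows. -/
lemma lt_of_isHadamard36 {M : Matrix idx idx ℤ} (hM : IsHadamard36 M) {i j : idx} {a b : ℕ}
    (ha : a < 408) (hb : b < 444) (hi : M i = vec (W a) ∨ M i = - vec (W a))
    (hj : M j = vec (W b) ∨ M j = - vec (W b)) : b < 408 := by
  by_contra hb'
  obtain ⟨h1, h2⟩ := isHadamard36_iff.1 hM
  have h3 := dotProduct_eq_or hi hj
  have h4 := ham_word_row ha (not_lt.1 hb') hb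
  rw [vec_dotProduct] at h3
  by_cases hij : i = j
  · rw [hij, dotProduct_self (h1 j)] at h3
    omega
  · rw [h2 i j hij] at h3
    omega

lemma eq_of_eq_or {M : Matrix idx idx ℤ} (hM : IsHadamard36 M) {i j : idx} {v : idx → ℤ}
    (hi : M i = v ∨ M i = -v) (hj : M j = v ∨ M j = -v) : i = j := by
  by_contra hij
  obtain ⟨h1, h2⟩ := isHadamard36_iff.1 hM
  have h3 : M i = M j ∨ M i = - M j := by
    rcases hi with hi | hi <;> rcases hj with hj | hj <;> rw [hi, hj] <;> simp
  have h4 := dotProduct_eq_or h3 (Or.inl (rfl : M j = M j))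
  rw [h2 i j hij, dotProduct_self (h1 j)] at h4
  norm_num at h4

lemma exists_signedPerm_secondMat {M : Matrix idx idx ℤ} (hM : IsHadamard36 M) {w : idx → ℕ}
    (hw : ∀ i, w i < 408) (hMw : ∀ i, M i = vec (W (w i)) ∨ M i = - vec (W (w i)))
    (h0 : ∃ i, M i = vec (W 0) ∨ M i = - vec (W 0)) :
    ∃ A, SignedPerm A ∧ ∀ i, ∃ k, A (M i) = secondMat k ∨ A (M i) = - secondMat k := by
  classical
  let S : Finset ℕ := {n ∈ range 408 | ∃ i, M i = vec (W n) ∨ M i = - vec (W n)}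
  have hS : ∀ n, n ∈ S ↔ n < 408 ∧ ∃ i, M i = vec (W n) ∨ M i = - vec (W n) := fun n => by
    simp [S]
  have hwS : ∀ i, w i ∈ S := fun i => (hS _).2 ⟨hw i, i, hMw i⟩
  obtain ⟨hM1, hM2⟩ := isHadamard36_iff.1 hM
  suffices h : (∀ a ∈ S, ∀ b ∈ S, (ham (W a) (W b) 36).testBit 3 = false) ∧
      ∀ b < 408, b ∉ S → 9 ≤ #{n ∈ S | (ham (W b) (W n) 36).testBit 3 = true} by
    obtain ⟨A, hA, hAS⟩ := exists_signedPerm_of_clique (fun n hn => ((hS n).1 hn).1)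
      ((hS 0).2 ⟨by norm_num, h0⟩) h.1 h.2
    refine ⟨A, hA, fun i => ?_⟩
    obtain ⟨k, hk⟩ := hAS _ (hwS i)
    refine ⟨k, ?_⟩
    rcases hMw i with e | e <;> rw [e]
    · exact hk
    · rw [hA.map_neg, neg_eq_iff_eq_neg, neg_inj]
      exact hk.symm
  refine ⟨fun a ha b hb => ?_, fun b hb hbS => ?_⟩
  · obtain ⟨ha, i, hi⟩ := (hS a).1 ha
    obtain ⟨hb, j, hj⟩ := (hS b).1 hb
    have h1 := dotProduct_eq_or hi hj
    rw [vec_dotProduct] at h1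
    by_cases hij : i = j
    · subst hij
      rw [dotProduct_self (hM1 i)] at h1
      rcases ham_word_word ha hb with h | h | h | h <;> rw [h] at h1 ⊢
      all_goals first | rfl | norm_num at h1
    · rw [hM2 i j hij] at h1
      rcases ham_word_word ha hb with h | h | h | h <;> rw [h] at h1 ⊢
      all_goals first | rfl | norm_num at h1
  · have h1 := sum_dotProduct_sq hM (vec (W b))
    rw [dotProduct_self (vec_eq_or _)] at h1
    have h2 : ∀ i, (vec (W b) ⬝ᵥ M i) ^ 2 =
        144 * if (ham (W b) (W (w i)) 36).testBit 3 = true then 1 else 0 := by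
      intro i
      have h3 := dotProduct_eq_or (Or.inl (rfl : vec (W b) = vec (W b))) (hMw i)
      rw [vec_dotProduct] at h3
      rw [sq_eq_sq_iff_eq_or_eq_neg.2 h3]
      rcases ham_word_word hb (hw i) with h | h | h | h
      · refine absurd ((hS b).2 ⟨hb, i, ?_⟩) hbS
        rw [vec_eq_of_ham h]
        exact hMw i
      all_goals
        rw [h]
        rfl
    simp only [h2] at h1
    rw [← Finset.mul_sum, Finset.sum_boole] at h1
    have h3 : #{i | (ham (W b) (W (w i)) 36).testBit 3 = true} = 9 := by
      zify
      omega
    rw [← h3]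
    refine Finset.card_le_card_of_injOn w (fun i hi => ?_) fun i _ j _ e =>
      eq_of_eq_or hM (hMw i) (e ▸ hMw j)
    simp only [Finset.coe_filter, Finset.mem_univ, true_and, Set.mem_ofPred_eq] at hi ⊢
    exact ⟨hwS i, hi⟩

theorem hadEquiv_or {M : Matrix idx idx ℤ} (hM : IsHadamard36 M)
    (hL : ∀ i, red (M i) ∈ Lcode (ZMod 17)) :
    HadEquiv M (Hmat (ZMod 17)) ∨ HadEquiv M secondMat := by
  obtain ⟨hM1, hM2⟩ := isHadamard36_iff.1 hM
  choose w hw hMw using fun i => exists_word (hM1 i) (hL i)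
  by_cases h : ∀ i, 408 ≤ w i
  · refine Or.inl (SignedPerm.refl.hadEquiv hM fun i => ⟨unpos (w i - 408), ?_⟩)
    have := hw i
    rw [Hmat_row, pos_unpos _ (by omega), Nat.add_sub_cancel' (h i)]
    exact hMw i
  · push Not at h
    obtain ⟨i₀, hi₀⟩ := h
    obtain ⟨A, hA, hAL, hA0⟩ := exists_signedPerm_word hi₀
    have hAM := hA.isHadamard36 hM
    have hA0' : A (M i₀) = vec (W 0) ∨ A (M i₀) = - vec (W 0) := by
      rcases hMw i₀ with e | e <;> rw [e]
      · exact hA0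
      · rw [hA.map_neg, neg_eq_iff_eq_neg, neg_inj]
        exact hA0.symm
    choose u hu hMu using fun i => exists_word (hAM.1 i) (hAL _ (hL i))
    have hu' : ∀ i, u i < 408 := fun i =>
      lt_of_isHadamard36 hAM (by norm_num) (hu i) hA0' (hMu i)
    obtain ⟨B, hB, hBM⟩ := exists_signedPerm_secondMat hAM hu' hMu ⟨i₀, hA0'⟩
    exact Or.inr ((hB.comp hA).hadEquiv hM hBM)

namespace SignedPerm

variable {A : (idx → ℤ) → idx → ℤ}

lemma exists_leftInverse (hA : SignedPerm A) : ∃ B, SignedPerm B ∧ ∀ f, B (A f) = f := by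
  obtain ⟨τ, s, hs, h⟩ := hA
  refine ⟨fun f j => s (τ.symm j) * f (τ.symm j),
    ⟨τ.symm, fun j => s (τ.symm j), fun j => hs _, fun f j => rfl⟩, fun f => ?_⟩
  funext j
  change s (τ.symm j) * A f (τ.symm j) = f j
  rw [h, τ.apply_symm_apply, ← mul_assoc, mul_self_of_sign (hs _), one_mul]

lemma red_mem (hA : SignedPerm A) {u : idx → ℤ} {c : idx → ZMod 3} {N : Matrix idx idx ℤ}
    {C : Submodule (ZMod 3) (idx → ZMod 3)} (hu : red u = ∑ k, c k • red (N k))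
    (hN : ∀ k, red (A (N k)) ∈ C) : red (A u) ∈ C := by
  obtain ⟨τ, s, -, h⟩ := hA
  have : red (A u) = ∑ k, c k • red (A (N k)) := by
    funext j
    have hj := congrFun hu (τ j)
    simp only [Finset.sum_apply, Pi.smul_apply, red, smul_eq_mul] at hj ⊢
    simp only [h, Int.cast_mul, hj, Finset.mul_sum]
    exact Finset.sum_congr rfl fun k _ => by ring
  rw [this]
  exact C.sum_mem fun k _ => C.smul_mem _ (hN k)

end SignedPerm

lemma exists_row_of_isMonomialZ {L : Matrix idx idx ℤ} (hL : IsMonomialZ L) (i : idx) :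
    ∃ (k : idx) (ε : ℤ), (ε = 1 ∨ ε = -1) ∧ ∀ f : idx → ℤ, ∑ j, L i j * f j = ε * f k := by
  obtain ⟨k, hk, huniq⟩ := hL.2.1 i
  refine ⟨k, L i k, (hL.1 i k).resolve_left hk, fun f => ?_⟩
  refine Finset.sum_eq_single k (fun j _ hj => ?_) fun h => absurd (Finset.mem_univ _) h
  rw [not_not.1 (mt (huniq j) hj), zero_mul]

lemma signedPerm_of_isMonomialZ {R : Matrix idx idx ℤ} (hR : IsMonomialZ R) :
    SignedPerm fun f j => ∑ i, f i * R i j := by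
  choose σ hσ huniq using hR.2.2
  have hinj : Function.Injective σ := fun j j' h =>
    (hR.2.1 (σ j)).unique (hσ j) (h ▸ hσ j')
  refine ⟨Equiv.ofBijective σ (Finite.injective_iff_bijective.1 hinj), fun j => R (σ j) j,
    fun j => (hR.1 _ _).resolve_left (hσ j), fun f j => ?_⟩
  refine (Finset.sum_eq_single (σ j) (fun i _ hi => ?_) fun h => absurd (Finset.mem_univ _) h).trans
    (mul_comm _ _)
  rw [not_not.1 (mt (huniq j i) hi), mul_zero]

lemma exists_signedPerm_of_hadEquiv {M N : Matrix idx idx ℤ} (h : HadEquiv M N) :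
    ∃ A, SignedPerm A ∧ ∀ k, ∃ i, A (N k) = M i ∨ A (N k) = - M i := by
  obtain ⟨L, R, hL, hR, rfl⟩ := h
  obtain ⟨A, hA, hAR⟩ := (signedPerm_of_isMonomialZ hR).exists_leftInverse
  refine ⟨A, hA, fun k => ?_⟩
  obtain ⟨i, ε, hε, h⟩ := exists_row_of_isMonomialZ hL k
  have e : (L * M * R) k = fun j => ∑ l, (ε • M i) l * R l j := by
    funext j
    rw [Matrix.mul_apply]
    refine Finset.sum_congr rfl fun l _ => ?_
    rw [Matrix.mul_apply, h fun j => M j l, Pi.smul_apply, smul_eq_mul]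
  refine ⟨i, ?_⟩
  rw [e, hAR]
  rcases hε with rfl | rfl
  · exact Or.inl (one_smul _ _)
  · exact Or.inr (by rw [neg_smul, one_smul])

/-- Coefficients of an expression of the word of number 1 by rows of the second matrix. -/
def coeffs : List ℤ := [2, 2, 1, 2, 0, 2, 2, 2, 2, 2, 1, 1, 1, 1, 0, 0, 0, 0, 1]

lemma dvd_sum_coeffs : ∀ j < 36, (3 : ℤ) ∣
    (∑ i ∈ range 36, coeffs.getD i 0 * sg (W (secondRow i)) j) - sg (W 1) j := by
  decide +kernel

lemma red_word_one : red (vec (W 1)) =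
    ∑ k, ((coeffs.getD (pos k) 0 : ℤ) : ZMod 3) • red (secondMat k) := by
  funext j
  have h := (ZMod.intCast_eq_intCast_iff_dvd_sub _ _ 3).2 (dvd_sum_coeffs (pos j) (pos_lt j))
  rw [← sum_pos fun i => coeffs.getD i 0 * sg (W (secondRow i)) (pos j)] at h
  refine h.trans ?_
  simp only [Finset.sum_apply, Pi.smul_apply, red, smul_eq_mul, Int.cast_sum, Int.cast_mul]
  rfl

lemma ham_secondRow_one : ham (W (secondRow 0)) (W 1) 36 = 18 ∧
    ham (W (secondRow 1)) (W 1) 36 = 12 := by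
  decide +kernel

theorem not_hadEquiv : ¬ HadEquiv (Hmat (ZMod 17)) secondMat := by
  intro h
  obtain ⟨A, hA, hAN⟩ := exists_signedPerm_of_hadEquiv h
  have hH := isHadamard36_iff.1 isHadamard36_Hmat
  have hmem : red (A (vec (W 1))) ∈ Lcode (ZMod 17) := by
    refine hA.red_mem red_word_one fun k => ?_
    obtain ⟨i, e | e⟩ := hAN k <;> rw [e, Hmat_row]
    · exact red_Hmat_mem i
    · rw [red_neg]
      exact Submodule.neg_mem _ (red_Hmat_mem i)
  have hone : ∀ j, A (vec (W 1)) j = 1 ∨ A (vec (W 1)) j = -1 := by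
    obtain ⟨τ, s, hs, e⟩ := hA
    intro j
    rw [e]
    rcases hs j with h1 | h1 <;> rcases vec_eq_or (W 1) (τ j) with h2 | h2 <;> rw [h1, h2] <;> simp
  obtain ⟨k, hk, hAk⟩ := exists_word hone hmem
  have hdot : ∀ n < 36, ∃ i, (36 - 2 * ham (W (secondRow n)) (W 1) 36 : ℤ) =
      Hmat (ZMod 17) i ⬝ᵥ vec (W k) ∨ (36 - 2 * ham (W (secondRow n)) (W 1) 36 : ℤ) =
      -(Hmat (ZMod 17) i ⬝ᵥ vec (W k)) := by
    intro n hn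
    obtain ⟨i, hi⟩ := hAN (unpos n)
    refine ⟨i, ?_⟩
    have := dotProduct_eq_or hi hAk
    rwa [hA.dotProduct, secondMat, pos_unpos n hn, vec_dotProduct] at this
  obtain ⟨h0, h1⟩ := ham_secondRow_one
  have hk' : 408 ≤ k := by
    by_contra hlt
    obtain ⟨i, hi⟩ := hdot 0 (by norm_num)
    have := ham_word_row (not_le.1 hlt) (Nat.le_add_right 408 (pos i)) (by
      have := pos_lt i
      omega)
    rw [h0, dotProduct_comm, Hmat_row, vec_dotProduct] at hi
    omega
  have hrow : vec (W k) = Hmat (ZMod 17) (unpos (k - 408)) := by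
    rw [Hmat_row, pos_unpos _ (by omega), Nat.add_sub_cancel' hk']
  obtain ⟨i, hi⟩ := hdot 1 (by norm_num)
  rw [h1, hrow] at hi
  by_cases e : i = unpos (k - 408)
  · rw [← e, dotProduct_self (hH.1 i)] at hi
    norm_num at hi
  · rw [hH.2 i _ e] at hi
    norm_num at hi

end PlessCode

/-- (Theorem 3(i), classification) Up to equivalence there are exactly two Hadamard
matrices of order 36 all of whose rows, reduced mod 3, are codewords of `L(17)`; one
of the two classes is represented by the Paley-type matrix `H`. -/
theorem stmt_13 :
    IsHadamard36 (Hmat (ZMod 17)) ∧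
    (∀ i, (fun j => ((Hmat (ZMod 17) i j : ℤ) : ZMod 3)) ∈ Lcode (ZMod 17)) ∧
    ∃ M₂ : Matrix idx idx ℤ,
      IsHadamard36 M₂ ∧
      (∀ i, (fun j => ((M₂ i j : ℤ) : ZMod 3)) ∈ Lcode (ZMod 17)) ∧
      ¬ HadEquiv (Hmat (ZMod 17)) M₂ ∧
      (∀ M : Matrix idx idx ℤ, IsHadamard36 M →
        (∀ i, (fun j => ((M i j : ℤ) : ZMod 3)) ∈ Lcode (ZMod 17)) →
        HadEquiv M (Hmat (ZMod 17)) ∨ HadEquiv M M₂) := by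
  exact ⟨PlessCode.isHadamard36_Hmat, fun i => by
      have h := PlessCode.red_Hmat_mem i
      rwa [← PlessCode.Hmat_row] at h,
    PlessCode.secondMat, PlessCode.isHadamard36_secondMat, PlessCode.red_secondMat_mem,
    PlessCode.not_hadEquiv, fun M hM hL => PlessCode.hadEquiv_or hM hL⟩
end

section
/- (Theorem 3(ii)) There exists a symmetric 2-(36,15,6) design D with trivial full automorphism group (the identity is its only automorphism) such that the row span over GF(3) of the 36×36 incidence matrix of D is a self-dual ternary code of length 36, dimension 18, and minimum weight 12 that is monomially equivalent to the Pless symmetry code C(17). -/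
open Matrix Finset

/-- The row of the generator matrix `(I | S_q)` of the Pless symmetry code,
reduced modulo 3, indexed by `i : Option F`. -/
def genRowC (F : Type) [Field F] [Fintype F] [DecidableEq F] (i : Option F) :
    (Option F ⊕ Option F) → ZMod 3 := fun j =>
  match j with
  | Sum.inl k => if i = k then 1 else 0
  | Sum.inr k => ((Smat F i k : ℤ) : ZMod 3)

/-- The Pless symmetry code `C(q)`: the ternary code of length `2q+2` spanned by
the rows of `(I | S_q)` reduced modulo 3. -/
def Ccode (F : Type) [Field F] [Fintype F] [DecidableEq F] :
    Submodule (ZMod 3) ((Option F ⊕ Option F) → ZMod 3) :=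
  Submodule.span (ZMod 3) (Set.range (genRowC F))

/-- A monomial matrix over `GF(3)`: exactly one nonzero entry in each row and column. -/
def IsMonomial3 (M : Matrix idx idx (ZMod 3)) : Prop :=
  (∀ i, ∃! j, M i j ≠ 0) ∧ (∀ j, ∃! i, M i j ≠ 0)

section Invariant

variable {α : Type*} [Fintype α]

/-- The number of blocks (rows) containing three given points (columns). -/
def tripleCount (N : Matrix α α ℤ) (p q r : α) : ℕ :=
  (univ.filter fun i => N i p = 1 ∧ N i q = 1 ∧ N i r = 1).card

def cubeSum (N : Matrix α α ℤ) (p q : α) : ℕ := ∑ r, tripleCount N p q r ^ 3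

def cubeDegree (N : Matrix α α ℤ) (p : α) : ℕ := ∑ q, cubeSum N p q

def cubeDegree₂ (N : Matrix α α ℤ) (p : α) : ℕ := ∑ q, cubeSum N p q * cubeDegree N q

variable {N : Matrix α α ℤ} {σ : Equiv.Perm α}

theorem tripleCount_apply_perm (hN : Function.Injective N)
    (hσ : ∀ i, ∃ i', ∀ j, N i (σ j) = N i' j) (p q r : α) :
    tripleCount N (σ p) (σ q) (σ r) = tripleCount N p q r := by
  choose τ hτ using hσ
  have hinj : Function.Injective τ := fun i i' h => hN <| funext fun j => by
    rw [← σ.apply_symm_apply j, hτ, hτ, h]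
  exact Finset.card_equiv (Equiv.ofBijective τ (Finite.injective_iff_bijective.1 hinj))
    fun i => by simp [hτ]

theorem cubeSum_apply_perm (hN : Function.Injective N)
    (hσ : ∀ i, ∃ i', ∀ j, N i (σ j) = N i' j) (p q : α) :
    cubeSum N (σ p) (σ q) = cubeSum N p q := by
  unfold cubeSum
  rw [← Equiv.sum_comp σ]
  simp only [tripleCount_apply_perm hN hσ]

theorem cubeDegree_apply_perm (hN : Function.Injective N)
    (hσ : ∀ i, ∃ i', ∀ j, N i (σ j) = N i' j) (p : α) :
    cubeDegree N (σ p) = cubeDegree N p := by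
  unfold cubeDegree
  rw [← Equiv.sum_comp σ]
  simp only [cubeSum_apply_perm hN hσ]

theorem cubeDegree₂_apply_perm (hN : Function.Injective N)
    (hσ : ∀ i, ∃ i', ∀ j, N i (σ j) = N i' j) (p : α) :
    cubeDegree₂ N (σ p) = cubeDegree₂ N p := by
  unfold cubeDegree₂
  rw [← Equiv.sum_comp σ]
  simp only [cubeSum_apply_perm hN hσ, cubeDegree_apply_perm hN hσ]

theorem eq_one_of_cubeDegree₂_injective (hN : Function.Injective N)
    (hdeg : Function.Injective (cubeDegree₂ N))
    (hσ : ∀ i, ∃ i', ∀ j, N i (σ j) = N i' j) : σ = 1 :=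
  Equiv.ext fun p => hdeg (cubeDegree₂_apply_perm hN hσ p)

end Invariant

section Popcount

/-- The number of ones among the lowest `12 * k` bits of `m`. -/
def popcount : ℕ → ℕ → ℕ
  | 0, _ => 0
  | k + 1, m =>
    (m % 4096 * 35185445863425 &&& 76861433640456465) % 15 + popcount k (m / 4096)

theorem sum_testBit_twelve_aux : ∀ a b : Fin 64,
    ∑ i ∈ range 12, ((64 * a + b : ℕ).testBit i).toNat =
      ((64 * a + b : ℕ) * 35185445863425 &&& 76861433640456465) % 15 := by
  decide +kernel

theorem sum_testBit_twelve {m : ℕ} (hm : m < 4096) :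
    ∑ i ∈ range 12, (m.testBit i).toNat =
      (m * 35185445863425 &&& 76861433640456465) % 15 := by
  have h := sum_testBit_twelve_aux ⟨m / 64, by omega⟩ ⟨m % 64, by omega⟩
  simpa only [Nat.div_add_mod] using h

theorem sum_testBit_eq_popcount (k m : ℕ) :
    ∑ i ∈ range (12 * k), (m.testBit i).toNat = popcount k m := by
  induction k generalizing m with
  | zero => rfl
  | succ k ih =>
    rw [Nat.mul_succ, Nat.add_comm, sum_range_add, popcount,
      ← sum_testBit_twelve (Nat.mod_lt _ (by norm_num)), ← ih]
    congr 1
    · refine sum_congr rfl fun i hi => ?_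
      rw [show 4096 = 2 ^ 12 by norm_num, Nat.testBit_mod_two_pow]
      simp [mem_range.1 hi]
    · refine sum_congr rfl fun i _ => ?_
      rw [show 4096 = 2 ^ 12 by norm_num, Nat.testBit_div_two_pow, Nat.add_comm]

end Popcount

section Design

/-- The columns of the incidence matrix: bit `i` of the `j`-th entry tells whether point `j` lies on
block `i`. -/
def pointMasks : List ℕ :=
  [36979489799, 11053638950, 15643444107, 19562993048, 30346091610, 20949665331,
   42014413558, 12163573337, 4913882308, 2876527720, 6754556609, 28471863540,
   51957489849, 52170395727, 9874917546, 1902860562, 44602512789, 47396341091,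
   43524536873, 26157830822, 9906456661, 13047575324, 35724887692, 22853124461,
   19491310341, 5286240403, 51645932370, 2089595744, 22637723041, 23253773838,
   37641824714, 41675704636, 38783487536, 61072281536, 67649794048, 68715413504]

/-- The off-diagonal values `960 + 6 * d` of `cubeSum incidence`: the digits `d` of row `p` form the
decimal numeral at place `p`. -/
def cubeRows : List ℕ :=
  [333222231233232233234243233232223230, 332221235423312221222325223242322303,
   334332223322223232141323320312223032, 333443343333332422322223423332320323,
   323123121320122312133321422213202222, 233342221241304303310222434031023232,
   121330212232221102122221222120132222, 233233222331223223341223323202313143,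
   222033323232323233323322033021023322, 334333333322332331123322230332423033,
   332522523233422222332232303322322223, 232134242322212222132113032032444322,
   434223335232312332022210322231213353, 233223323232333232232101132222222224,
   433333333232322433222012123322232332, 513332132231251332230222223312032124,
   323332322332333313303232332242132423, 522323033322335221032220131331313122,
   312323133322322320132322221332322213, 123135643563331202213333223320012323,
   234312123233332023233423223221334222, 613221132221420212531232222331422322,
   532220122212302332335231123222023213, 322433231333034333332333243322313232,
   313222322220321332221222232212103233, 322235132202312362233333232333423223,
   322223523022322253332222323232233342, 210322010322122333322335233322113351,
   132333301232323243323323423221224233, 333523030513211161031333253322213222,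
   331240332352301253322333423330233212, 332304232232322132233322323333424322,
   333032533222422313333322153023314322, 210321320223223432233334224231333423,
   201333331221231321221333333232323333, 22333312333356213535424233221233333]

/-- The values of `cubeDegree` on the 36 points. -/
def cubeDegrees : List ℕ :=
  [45069, 45057, 45033, 45129, 44961, 45009, 44901, 45045, 45009,
   45081, 45081, 45021, 45057, 45021, 45069, 45021, 45081, 45009,
   45009, 45081, 45057, 45021, 44997, 45105, 44973, 45093, 45081,
   45009, 45069, 45045, 45069, 45081, 45081, 45057, 45033, 45141]

/-- The values of `cubeDegree₂` on the 36 points. -/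
def cubeDegrees₂ : List ℕ :=
  [2030408433, 2029748265, 2028428865, 2033709057, 2024466921, 2027110761,
   2021165217, 2029089609, 2027109177, 2031069897, 2031068457, 2027768481,
   2029751793, 2027767833, 2030409441, 2027770065, 2031067737, 2027110545,
   2027108313, 2031071337, 2029748481, 2027769921, 2026449081, 2032390161,
   2025130257, 2031729849, 2031068745, 2027108097, 2030409945, 2029092849,
   2030412033, 2031068961, 2031070185, 2029748769, 2028429297, 2034367785]

/-- The numbering of the coordinates of `C(17)` by `0, …, 35`. -/
def coord : Fin 36 ≃ idx :=
  (finSumFinEquiv (m := 18) (n := 18)).symm.trans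
    ((finSuccEquiv 17).sumCongr (finSuccEquiv 17))

def pointMask (j : Fin 36) : ℕ := pointMasks[j]

/-- The incidence matrix of a symmetric 2-(36,15,6) design without nontrivial automorphisms. -/
def incidence : Matrix idx idx ℤ := fun i j =>
  if (pointMask (coord.symm j)).testBit (coord.symm i) then 1 else 0

theorem incidence_eq_one_iff {i j : idx} :
    incidence i j = 1 ↔ (pointMask (coord.symm j)).testBit (coord.symm i) := by
  simp [incidence]

theorem card_filter_testBit (m : ℕ) :
    (univ.filter fun i : idx => m.testBit (coord.symm i)).card = popcount 3 m := by
  rw [← sum_testBit_eq_popcount, ← Fin.sum_univ_eq_sum_range fun i => (m.testBit i).toNat,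
    card_filter, ← Equiv.sum_comp coord]
  simp [Bool.toNat, Bool.cond_eq_ite]

theorem card_row : ∀ i, (univ.filter fun j => incidence i j = 1).card = 15 := by
  decide +kernel

theorem popcount_pair : ∀ p q : Fin 36, p ≠ q →
    popcount 3 (pointMask p &&& pointMask q) = 6 := by
  decide +kernel

theorem card_pair {p q : idx} (h : p ≠ q) :
    (univ.filter fun i => incidence i p = 1 ∧ incidence i q = 1).card = 6 := by
  rw [← popcount_pair _ _ (coord.symm.injective.ne h), ← card_filter_testBit]
  simp only [incidence_eq_one_iff, Nat.testBit_and, Bool.and_eq_true]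

theorem tripleCount_incidence (p q r : Fin 36) :
    tripleCount incidence (coord p) (coord q) (coord r) =
      popcount 3 (pointMask p &&& pointMask q &&& pointMask r) := by
  rw [tripleCount, ← card_filter_testBit]
  simp only [incidence_eq_one_iff, Nat.testBit_and, Bool.and_eq_true, Equiv.symm_apply_apply,
    and_assoc]

theorem incidence_injective : Function.Injective incidence := by
  have h : ∀ i i' : Fin 36,
      (∀ j, (pointMask j).testBit i = (pointMask j).testBit i') → i = i' := by
    decide +kernel
  refine fun i i' hi => coord.symm.injective (h _ _ fun j => Bool.eq_iff_iff.2 ?_)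
  have hj := congrFun hi (coord j)
  rw [← coord.symm_apply_apply j, ← incidence_eq_one_iff, ← incidence_eq_one_iff, hj]

def cubeEntry (p q : Fin 36) : ℕ :=
  if p = q then 10935 else 960 + 6 * (cubeRows[p] / 10 ^ (q : ℕ) % 10)

theorem cubeEntry_comm : ∀ p q, cubeEntry p q = cubeEntry q p := by
  decide +kernel

theorem sum_popcount_eq_cubeEntry : ∀ p q : Fin 36, p ≤ q →
    (pointMasks.map fun m => popcount 3 (pointMask p &&& pointMask q &&& m) ^ 3).sum =
      cubeEntry p q := by
  decide +kernel

theorem cubeSum_incidence (p q : Fin 36) :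
    cubeSum incidence (coord p) (coord q) = cubeEntry p q := by
  wlog h : p ≤ q generalizing p q
  · rw [cubeEntry_comm, ← this q p (le_of_not_ge h)]
    simp only [cubeSum, tripleCount, and_left_comm]
  rw [← sum_popcount_eq_cubeEntry p q h, cubeSum, ← Equiv.sum_comp coord]
  simp only [tripleCount_incidence]
  exact Fin.sum_univ_fun_getElem pointMasks fun m =>
    popcount 3 (pointMask p &&& pointMask q &&& m) ^ 3

theorem cubeDegree_incidence (p : Fin 36) :
    cubeDegree incidence (coord p) = cubeDegrees[p] := by
  have h : ∀ p : Fin 36, ∑ q, cubeEntry p q = cubeDegrees[p] := by decide +kernel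
  rw [cubeDegree, ← Equiv.sum_comp coord, ← h]
  simp only [cubeSum_incidence]

theorem cubeDegree₂_incidence (p : Fin 36) :
    cubeDegree₂ incidence (coord p) = cubeDegrees₂[p] := by
  have h : ∀ p : Fin 36, ∑ q, cubeEntry p q * cubeDegrees[q] = cubeDegrees₂[p] := by
    decide +kernel
  rw [cubeDegree₂, ← Equiv.sum_comp coord, ← h]
  simp only [cubeSum_incidence, cubeDegree_incidence]

theorem cubeDegree₂_incidence_injective : Function.Injective (cubeDegree₂ incidence) := by
  have h : ∀ p q : Fin 36, cubeDegrees₂[p] = cubeDegrees₂[q] → p = q := by decide +kernel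
  intro p q hpq
  rw [← coord.apply_symm_apply p, ← coord.apply_symm_apply q, cubeDegree₂_incidence,
    cubeDegree₂_incidence] at hpq
  exact coord.symm.injective (h _ _ hpq)

end Design

section GraphCode

variable {n K : Type*} [Fintype n] [Field K]

/-- The code with generator matrix `(I | T)`, given by its systematic encoder. -/
def graphEncode (T : Matrix n n K) : (n → K) →ₗ[K] (n ⊕ n → K) where
  toFun x := Sum.elim x (x ᵥ* T)
  map_add' x y := by ext (i | i) <;> simp [add_vecMul]
  map_smul' a x := by ext (i | i) <;> simp [smul_vecMul]

abbrev graphCode (T : Matrix n n K) : Submodule K (n ⊕ n → K) :=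
  LinearMap.range (graphEncode T)

theorem graphEncode_apply (T : Matrix n n K) (x : n → K) :
    graphEncode T x = Sum.elim x (x ᵥ* T) := rfl

theorem mem_graphCode_iff {T : Matrix n n K} {v : n ⊕ n → K} :
    v ∈ graphCode T ↔ (v ∘ Sum.inl) ᵥ* T = v ∘ Sum.inr := by
  refine ⟨?_, fun h => ⟨v ∘ Sum.inl, ?_⟩⟩
  · rintro ⟨x, rfl⟩
    rfl
  · rw [graphEncode_apply, h, Sum.elim_comp_inl_inr]

theorem finrank_graphCode (T : Matrix n n K) :
    Module.finrank K (graphCode T) = Fintype.card n := by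
  rw [LinearMap.finrank_range_of_inj, Module.finrank_fintype_fun_eq_card]
  intro x y h
  simpa [graphEncode_apply] using congrArg (· ∘ Sum.inl) h

/-- Codewords of `graphCode T` span it as soon as their left halves have a left inverse. -/
theorem span_eq_graphCode [DecidableEq n] {ι : Type*} {T : Matrix n n K} {N : ι → n ⊕ n → K}
    (hN : ∀ i, N i ∈ graphCode T) (f : n → ι) {B : Matrix n n K}
    (hB : B * Matrix.of (fun i j => N (f i) (Sum.inl j)) = 1) :
    Submodule.span K (Set.range N) = graphCode T := by
  refine le_antisymm (Submodule.span_le.2 (Set.range_subset_iff.2 hN)) ?_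
  rintro _ ⟨x, rfl⟩
  have hx : x = ∑ i, (x ᵥ* B) i • (N (f i) ∘ Sum.inl) := by
    conv_lhs => rw [← vecMul_one x, ← hB, ← vecMul_vecMul, vecMul_eq_sum]
    rfl
  have hf : ∀ i, graphEncode T (N (f i) ∘ Sum.inl) = N (f i) := fun i => by
    rw [graphEncode_apply, mem_graphCode_iff.1 (hN (f i)), Sum.elim_comp_inl_inr]
  rw [hx, map_sum]
  refine Submodule.sum_mem _ fun i _ => ?_
  rw [map_smul, hf]
  exact Submodule.smul_mem _ _ (Submodule.subset_span ⟨f i, rfl⟩)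

theorem dotProduct_graphEncode (T : Matrix n n K) (v : n ⊕ n → K) (x : n → K) :
    v ⬝ᵥ graphEncode T x = (v ∘ Sum.inl + T *ᵥ (v ∘ Sum.inr)) ⬝ᵥ x := by
  rw [add_dotProduct, ← dotProduct_comm x, ← dotProduct_comm x, dotProduct_mulVec,
    dotProduct_comm x, dotProduct_comm (x ᵥ* T)]
  simp [graphEncode_apply, dotProduct, Fintype.sum_sum_type]

theorem mem_graphCode_iff_forall_dotProduct [DecidableEq n] {T : Matrix n n K} (hT : T * Tᵀ = -1)
    {v : n ⊕ n → K} : v ∈ graphCode T ↔ ∀ c ∈ graphCode T, v ⬝ᵥ c = 0 := by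
  have hT' : Tᵀ * T = -1 := by
    have h : T * -Tᵀ = 1 := by rw [Matrix.mul_neg, hT, neg_neg]
    rw [← neg_neg (Tᵀ * T), ← Matrix.neg_mul, mul_eq_one_comm.1 h]
  have hdual : (∀ c ∈ graphCode T, v ⬝ᵥ c = 0) ↔
      v ∘ Sum.inl + T *ᵥ (v ∘ Sum.inr) = 0 := by
    rw [← dotProduct_eq_zero_iff]
    simp [dotProduct_graphEncode]
  rw [hdual, mem_graphCode_iff, ← mulVec_transpose]
  constructor <;> intro h
  · rw [← h, mulVec_mulVec, hT, neg_mulVec, one_mulVec, add_neg_cancel]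
  · rw [eq_neg_of_add_eq_zero_left h, mulVec_neg, mulVec_mulVec, hT', neg_mulVec, one_mulVec,
      neg_neg]

theorem hammingNorm_graphEncode [DecidableEq K] (T : Matrix n n K) (x : n → K) :
    hammingNorm (graphEncode T x) = hammingNorm x + hammingNorm (x ᵥ* T) := by
  simp only [hammingNorm, card_filter, Fintype.sum_sum_type]
  rfl

end GraphCode

theorem natCast_hammingNorm_eq_dotProduct {ι : Type*} [Fintype ι] (v : ι → ZMod 3) :
    (hammingNorm v : ZMod 3) = v ⬝ᵥ v := by
  have h : ∀ a : ZMod 3, (if a ≠ 0 then 1 else 0) = a * a := by decide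
  simp [hammingNorm, card_filter, dotProduct, ← h]

section DigitWeight

/-- The number of the lowest `k` digits of `a` in base 100 that are not divisible by 3. -/
def digitWeight : ℕ → ℕ → ℕ
  | 0, _ => 0
  | k + 1, a => (a % 100 % 3 + 1) / 2 + digitWeight k (a / 100)

theorem digitWeight_sum {k : ℕ} (D : Fin k → ℕ) (hD : ∀ j, D j < 100) :
    digitWeight k (∑ j, D j * 100 ^ (j : ℕ)) = hammingNorm fun j => (D j : ZMod 3) := by
  induction k with
  | zero => rfl
  | succ k ih =>
    have hsum : ∑ j, D j * 100 ^ (j : ℕ) =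
        D 0 + 100 * ∑ j : Fin k, D j.succ * 100 ^ (j : ℕ) := by
      simp [Fin.sum_univ_succ, pow_succ, mul_sum, mul_comm, mul_left_comm]
    have h0 : (D 0 % 3 + 1) / 2 = if (D 0 : ZMod 3) ≠ 0 then 1 else 0 := by
      simp only [ne_eq, ZMod.natCast_eq_zero_iff]
      split_ifs <;> omega
    have := hD 0
    rw [hsum, digitWeight, show ∀ b, (D 0 + 100 * b) % 100 = D 0 by omega,
      show ∀ b, (D 0 + 100 * b) / 100 = b by omega, ih (fun j => D j.succ) fun j => hD _, h0,
      hammingNorm, hammingNorm, card_filter, card_filter, Fin.sum_univ_succ]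

/-- The digits do not overflow when rows of a ternary matrix are combined as numerals. -/
theorem digitWeight_sum_mul {k : ℕ} (hk : k < 25) {L : Fin k → ℕ}
    {A : Matrix (Fin k) (Fin k) (ZMod 3)} (hL : ∀ i, L i = ∑ j, (A i j).val * 100 ^ (j : ℕ))
    (x : Fin k → ZMod 3) :
    digitWeight k (∑ i, (x i).val * L i) = hammingNorm (x ᵥ* A) := by
  have hlt (j : Fin k) : ∑ i, (x i).val * (A i j).val < 100 := by
    have h4 : ∀ a b : ZMod 3, a.val * b.val ≤ 4 := by decide
    calc _ ≤ ∑ _i : Fin k, 4 := sum_le_sum fun i _ => h4 _ _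
      _ = k * 4 := by simp
      _ < 100 := by omega
  have hcast : ∀ a : ZMod 3, ((a.val : ℕ) : ZMod 3) = a := by decide
  have hvec : x ᵥ* A = fun j => ((∑ i, (x i).val * (A i j).val : ℕ) : ZMod 3) := by
    ext j
    simp only [Nat.cast_sum, Nat.cast_mul, hcast, vecMul, dotProduct]
  rw [hvec, ← digitWeight_sum _ hlt]
  congr 1
  simp_rw [hL, mul_sum, sum_mul]
  rw [sum_comm]
  simp_rw [mul_assoc]

attribute [irreducible] digitWeight

/-- Checks that every sum of `a` and of at most `d` entries of `L` with coefficients 1 or 2 has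
digit weight at least 10, when `w` and the number of entries used are added to it. -/
def checkSums : List ℕ → ℕ → ℕ → ℕ → Bool
  | [], _, w, a => Nat.ble 10 (w + digitWeight 18 a)
  | _ :: _, 0, w, a => Nat.ble 10 (w + digitWeight 18 a)
  | r :: L, d + 1, w, a =>
    checkSums L (d + 1) w a && checkSums L d (w + 1) (a + r) && checkSums L d (w + 1) (a + 2 * r)

theorem le_of_checkSums {k : ℕ} (L : Fin k → ℕ) {d w a : ℕ}
    (h : checkSums (List.ofFn L) d w a) (c : Fin k → ZMod 3) (hc : hammingNorm c ≤ d) :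
    10 ≤ w + hammingNorm c + digitWeight 18 (a + ∑ i, (c i).val * L i) := by
  induction k generalizing d w a with
  | zero => simpa [checkSums, hammingNorm] using h
  | succ k ih =>
    have hnorm : hammingNorm c =
        (if c 0 ≠ 0 then 1 else 0) + hammingNorm fun i : Fin k => c i.succ := by
      simp only [hammingNorm, card_filter, Fin.sum_univ_succ]
    rw [List.ofFn_succ] at h
    cases d with
    | zero =>
      have hc0 : c = 0 := hammingNorm_eq_zero.1 (Nat.le_zero.1 hc)
      simpa [checkSums, hc0] using h
    | succ d =>
      simp only [checkSums, Bool.and_eq_true] at h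
      rw [Fin.sum_univ_succ, ← add_assoc]
      have hval : c 0 = 0 ∨ c 0 = 1 ∨ c 0 = 2 := by
        generalize c 0 = b
        revert b
        decide
      rcases hval with h0 | h0 | h0
      · have := ih _ h.1.1 (fun i => c i.succ) (by simp [hnorm, h0] at hc; omega)
        simpa [hnorm, h0] using this
      · have h1 : (1 : ZMod 3).val = 1 := rfl
        have := ih _ h.1.2 (fun i => c i.succ) (by simp [hnorm, h0] at hc; omega)
        simpa [hnorm, h0, h1, add_assoc] using this
      · have hval2 : (2 : ZMod 3).val = 2 := rfl
        have h2 : (2 : ZMod 3) ≠ 0 := by decide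
        have := ih _ h.2 (fun i => c i.succ) (by simp [hnorm, h0, h2] at hc; omega)
        simpa [hnorm, h0, h2, hval2, add_assoc] using this

end DigitWeight

section Pless

/-- The matrix `S₁₇` modulo 3. -/
def plessMatrix : Matrix (Option (ZMod 17)) (Option (ZMod 17)) (ZMod 3) :=
  (Smat (ZMod 17)).map (↑)

theorem Ccode_eq_graphCode : Ccode (ZMod 17) = graphCode plessMatrix := by
  have hinl : ∀ i, genRowC (ZMod 17) i ∘ Sum.inl = Pi.single i 1 := fun i => by
    ext k
    simp [genRowC, Pi.single_apply, eq_comm]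
  refine span_eq_graphCode (fun i => ?_) id (B := 1) ?_
  · rw [mem_graphCode_iff, hinl, single_one_vecMul]
    rfl
  · rw [one_mul]
    ext i j
    simp [genRowC, one_apply]

theorem plessMatrix_transpose : plessMatrixᵀ = plessMatrix := by
  have h : ∀ x : Option (ZMod 17) × Option (ZMod 17),
      plessMatrix x.2 x.1 = plessMatrix x.1 x.2 := by
    decide +kernel
  ext i j
  exact h (i, j)

theorem plessMatrix_mul_self : plessMatrix * plessMatrix = -1 := by
  have h : ∀ i j, ∑ k, plessMatrix i k * plessMatrix k j = if i = j then -1 else 0 := by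
    decide +kernel
  ext i j
  rw [mul_apply, h, neg_apply, one_apply]
  split_ifs <;> simp

def plessIdx : Fin 18 ≃ Option (ZMod 17) :=
  (Equiv.swap 0 1).trans (finSuccEquiv 17)

/-- The rows of `plessMatrix` in the order of `plessIdx`, with the entries `0, 1, 2` as the digits,
from the right, of a numeral in base 100. -/
def plessRows : List ℕ :=
  [10102010202020101020202010201010100, 10101010101010101010101010101010001,
   10201020202010102020201020101000101, 20102020201010202020102010100010101,
   10202020101020202010201010001010102, 20202010102020201020101000101020101,
   20201010202020102010100010102010102, 20101020202010201010001010201020102,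
   10102020201020101000101020102020102, 10202020102010100010102010202020101,
   20202010201010001010201020202010101, 20201020101000101020102020201010102,
   20102010100010102010202020101020102, 10201010001010201020202010102020102,
   20101000101020102020201010202020101, 10100010102010202020101020202010102,
   10001010201020202010102020201020101, 101020102020201010202020102010101]

theorem plessRows_eq : ∀ i : Fin 18, plessRows[i] =
    ∑ j : Fin 18, (plessMatrix (plessIdx i) (plessIdx j)).val * 100 ^ (j : ℕ) := by
  decide +kernel

theorem hammingNorm_comp_equiv {ι κ K : Type*} [Fintype ι] [Fintype κ] [Zero K] [DecidableEq K]
    (e : ι ≃ κ) (x : κ → K) : hammingNorm (x ∘ e) = hammingNorm x := by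
  simp only [hammingNorm, card_filter]
  exact Equiv.sum_comp e fun i => if x i ≠ 0 then 1 else 0

theorem digitWeight_sum_plessRows (x : Option (ZMod 17) → ZMod 3) :
    digitWeight 18 (∑ i : Fin 18, (x (plessIdx i)).val * plessRows[i]) =
      hammingNorm (x ᵥ* plessMatrix) := by
  have hvec : (x ∘ plessIdx) ᵥ* plessMatrix.submatrix plessIdx plessIdx =
      (x ᵥ* plessMatrix) ∘ plessIdx := by
    rw [submatrix_vecMul_equiv, Function.comp_assoc, Equiv.self_comp_symm, Function.comp_id]
  rw [← hammingNorm_comp_equiv plessIdx, ← hvec]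
  exact digitWeight_sum_mul (by simp) plessRows_eq (x ∘ plessIdx)

theorem checkSums_plessRows :
    checkSums (List.ofFn fun i : Fin 17 => plessRows[i.succ]) 3 1 plessRows[0] = true := by
  have h : checkSums plessRows.tail 3 1 plessRows[0] = true := by decide +kernel
  exact h

variable {x : Option (ZMod 17) → ZMod 3}

theorem ten_le_of_apply_zero_eq_one (hx : hammingNorm x ≤ 4) (h0 : x (some 0) = 1) :
    10 ≤ hammingNorm x + hammingNorm (x ᵥ* plessMatrix) := by
  have hidx : x (plessIdx 0) = 1 := h0
  have hnorm : hammingNorm x = 1 + hammingNorm fun i : Fin 17 => x (plessIdx i.succ) := by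
    rw [← hammingNorm_comp_equiv plessIdx]
    simp [hammingNorm, card_filter, Fin.sum_univ_succ, hidx]
  have := le_of_checkSums _ checkSums_plessRows (fun i => x (plessIdx i.succ)) (by omega)
  have h1 : (1 : ZMod 3).val * plessRows[0] = plessRows[0] := one_mul _
  rw [hnorm, ← digitWeight_sum_plessRows, Fin.sum_univ_succ, hidx]
  exact h1.symm ▸ this

theorem ten_le_of_apply_zero_ne_zero (hx : hammingNorm x ≤ 4) (h0 : x (some 0) ≠ 0) :
    10 ≤ hammingNorm x + hammingNorm (x ᵥ* plessMatrix) := by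
  have hsq : ∀ a : ZMod 3, a ≠ 0 → a * a = 1 := by decide
  have hsmul : ∀ {ι : Type} [Fintype ι] (y : ι → ZMod 3),
      hammingNorm (x (some 0) • y) = hammingNorm y :=
    fun y => hammingNorm_smul (fun _ => IsSMulRegular.of_ne_zero h0) y
  have := ten_le_of_apply_zero_eq_one (x := x (some 0) • x) (by rwa [hsmul]) (hsq _ h0)
  rwa [smul_vecMul, hsmul, hsmul] at this

/-- The translation by `a`, an automorphism of the Pless symmetry code in both halves. -/
def plessTranslate (a : ZMod 17) : Option (ZMod 17) ≃ Option (ZMod 17) :=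
  Equiv.optionCongr (Equiv.addRight a)

theorem plessMatrix_submatrix_plessTranslate (a : ZMod 17) :
    plessMatrix.submatrix (plessTranslate a) (plessTranslate a) = plessMatrix := by
  ext (_ | i) (_ | j) <;> simp [plessMatrix, plessTranslate, Smat]

theorem ten_le_hammingNorm_add (hx : hammingNorm x ≤ 4) (hx0 : x ≠ 0) :
    10 ≤ hammingNorm x + hammingNorm (x ᵥ* plessMatrix) := by
  by_cases h : ∃ a, x (some a) ≠ 0
  · obtain ⟨a, ha⟩ := h
    have hmul : (x ∘ plessTranslate a) ᵥ* plessMatrix = (x ᵥ* plessMatrix) ∘ plessTranslate a := by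
      conv_lhs => rw [← plessMatrix_submatrix_plessTranslate a]
      rw [submatrix_vecMul_equiv]
      simp [Function.comp_assoc]
    have := ten_le_of_apply_zero_ne_zero (x := x ∘ plessTranslate a)
      (by rwa [hammingNorm_comp_equiv]) (by simpa [plessTranslate] using ha)
    rwa [hmul, hammingNorm_comp_equiv, hammingNorm_comp_equiv] at this
  · push Not at h
    have hnone : x none ≠ 0 := fun h0 => hx0 <| funext fun i => i.rec h0 h
    have hmul : ∀ b, (x ᵥ* plessMatrix) (some b) = x none := fun b => by
      simp [vecMul, dotProduct, Fintype.sum_option, h, plessMatrix, Smat]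
    have : 17 ≤ hammingNorm (x ᵥ* plessMatrix) := by
      simp [hammingNorm, card_filter, Fintype.sum_option, hmul, hnone]
    omega

/-- The Pless symmetry code has minimum weight at least 12. -/
theorem twelve_le_hammingNorm_add (hx0 : x ≠ 0) :
    12 ≤ hammingNorm x + hammingNorm (x ᵥ* plessMatrix) := by
  have hself : plessMatrix * plessMatrixᵀ = -1 := by
    rw [plessMatrix_transpose, plessMatrix_mul_self]
  have hdvd : 3 ∣ hammingNorm x + hammingNorm (x ᵥ* plessMatrix) := by
    rw [← hammingNorm_graphEncode, ← ZMod.natCast_eq_zero_iff, natCast_hammingNorm_eq_dotProduct]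
    exact (mem_graphCode_iff_forall_dotProduct hself).1 ⟨x, rfl⟩ _ ⟨x, rfl⟩
  have hmul : (x ᵥ* plessMatrix) ᵥ* plessMatrix = -x := by
    rw [vecMul_vecMul, plessMatrix_mul_self, vecMul_neg, vecMul_one]
  have hne : x ᵥ* plessMatrix ≠ 0 := fun h => hx0 (by simpa [h] using hmul.symm)
  have hneg : hammingNorm (-x) = hammingNorm x := by simp [hammingNorm]
  have hleft := fun h => ten_le_hammingNorm_add (x := x) h hx0
  have hright := fun h => ten_le_hammingNorm_add (x := x ᵥ* plessMatrix) h hne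
  rw [hmul, hneg] at hright
  omega

end Pless

section RowSpace

/-- The column signs that make the rows of `incidence` codewords of the Pless symmetry code. -/
def colSign (k : Option (ZMod 17)) : ZMod 3 := if k = none then -1 else 1

theorem colSign_mul_self (k : Option (ZMod 17)) : colSign k * colSign k = 1 := by
  unfold colSign
  split_ifs <;> decide

theorem colSign_ne_zero (k : Option (ZMod 17)) : colSign k ≠ 0 :=
  left_ne_zero_of_mul_eq_one (colSign_mul_self k)

def signedPlessMatrix : Matrix (Option (ZMod 17)) (Option (ZMod 17)) (ZMod 3) :=
  plessMatrix * diagonal colSign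

theorem vecMul_signedPlessMatrix (x : Option (ZMod 17) → ZMod 3) (k : Option (ZMod 17)) :
    (x ᵥ* signedPlessMatrix) k = (x ᵥ* plessMatrix) k * colSign k := by
  rw [signedPlessMatrix, ← vecMul_vecMul, vecMul_diagonal]

theorem signedPlessMatrix_mul_transpose : signedPlessMatrix * signedPlessMatrixᵀ = -1 := by
  rw [signedPlessMatrix, transpose_mul, diagonal_transpose, Matrix.mul_assoc,
    ← Matrix.mul_assoc (diagonal _), diagonal_mul_diagonal]
  simp_rw [colSign_mul_self]
  rw [diagonal_one, one_mul, plessMatrix_transpose, plessMatrix_mul_self]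

theorem hammingNorm_vecMul_signedPlessMatrix (x : Option (ZMod 17) → ZMod 3) :
    hammingNorm (x ᵥ* signedPlessMatrix) = hammingNorm (x ᵥ* plessMatrix) := by
  simp [hammingNorm, vecMul_signedPlessMatrix, colSign_ne_zero]

def incidence₃ (i j : idx) : ZMod 3 := incidence i j

theorem incidence₃_mem (i : idx) : incidence₃ i ∈ graphCode signedPlessMatrix := by
  have h : ∀ i k, (∑ l, incidence₃ i (Sum.inl l) * plessMatrix l k) * colSign k =
      incidence₃ i (Sum.inr k) := by
    decide +kernel
  rw [mem_graphCode_iff]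
  ext k
  rw [vecMul_signedPlessMatrix]
  exact h i k

/-- The rows of the inverse modulo 3 of the upper left quarter of the incidence matrix, as decimal
numerals whose digits, from the right, are the entries. -/
def leftInverseRows : List ℕ :=
  [101021122122110210, 122021101100002202, 100122101212212210,
   201120222200112112, 102000200000000000, 211210010012021122,
   222202110210212201, 222222000110002102, 112022221212201210,
   100002010220222221, 211210110122222001, 222010012101001011,
   220110210021020201, 100020020110110001, 221100200120022122,
   112022122201011022, 120100110111000201, 11011010212002222]

def leftInverse : Matrix (Option (ZMod 17)) (Option (ZMod 17)) (ZMod 3) :=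
  ((Matrix.of fun i j : Fin 18 => leftInverseRows[i] / 10 ^ (j : ℕ) % 10).submatrix
    (finSuccEquiv 17).symm (finSuccEquiv 17).symm).map (↑)

theorem leftInverse_mul :
    leftInverse * Matrix.of (fun i j => incidence₃ (Sum.inl i) (Sum.inl j)) = 1 := by
  have h : ∀ i j, ∑ k, leftInverse i k * incidence₃ (Sum.inl k) (Sum.inl j) =
      if i = j then 1 else 0 := by
    decide +kernel
  ext i j
  rw [mul_apply, one_apply, ← h]
  rfl

theorem span_incidence₃ :
    Submodule.span (ZMod 3) (Set.range incidence₃) = graphCode signedPlessMatrix :=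
  span_eq_graphCode incidence₃_mem Sum.inl leftInverse_mul

/-- Ones on the left half and `colSign` on the right half of the diagonal. -/
def signMatrix : Matrix idx idx (ZMod 3) := diagonal (Sum.elim 1 colSign)

theorem isMonomial3_signMatrix : IsMonomial3 signMatrix := by
  have h : ∀ i, (Sum.elim 1 colSign : idx → ZMod 3) i ≠ 0 := by
    rintro (i | i)
    · exact one_ne_zero
    · exact colSign_ne_zero i
  have h' : ∀ i j, signMatrix i j ≠ 0 ↔ i = j := fun i j => by
    simp [signMatrix, diagonal_apply, h]
  exact ⟨fun i => ⟨i, by simp [h', eq_comm]⟩, fun j => ⟨j, by simp [h']⟩⟩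

theorem vecMul_signMatrix_image :
    (fun c => vecMul c signMatrix) '' (Ccode (ZMod 17) : Set (idx → ZMod 3)) =
      graphCode signedPlessMatrix := by
  have h (x : Option (ZMod 17) → ZMod 3) :
      vecMul (graphEncode plessMatrix x) signMatrix = graphEncode signedPlessMatrix x := by
    ext (k | k) <;>
      simp [signMatrix, vecMul_diagonal, graphEncode_apply, vecMul_signedPlessMatrix]
  rw [Ccode_eq_graphCode, LinearMap.coe_range, LinearMap.coe_range, ← Set.range_comp]
  exact congrArg Set.range (funext h)

theorem exists_hammingNorm_eq_twelve :
    ∃ x, x ≠ 0 ∧ hammingNorm (graphEncode signedPlessMatrix x) = 12 := by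
  refine ⟨fun i => if i = none ∨ i = some 0 then 1 else 0, fun h => ?_, ?_⟩
  · simpa using congrFun h none
  · decide +kernel

end RowSpace

/-- (Theorem 3(ii)) There exists a symmetric 2-(36,15,6) design with trivial full
automorphism group whose incidence matrix spans over `GF(3)` a self-dual ternary
code of length 36, dimension 18 and minimum weight 12 that is monomially equivalent
to the Pless symmetry code `C(17)`. -/
theorem stmt_14 :
    ∃ (N : Matrix idx idx ℤ) (C' : Submodule (ZMod 3) (idx → ZMod 3)),
      -- C' is the row span over GF(3) of the incidence matrix N
      C' = Submodule.span (ZMod 3)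
        (Set.range (fun i => fun j => ((N i j : ℤ) : ZMod 3))) ∧
      -- N is a (0,1)-matrix
      (∀ i j, N i j = 0 ∨ N i j = 1) ∧
      -- N is the incidence matrix of a symmetric 2-(36,15,6) design:
      (∀ i, (Finset.univ.filter (fun j => N i j = 1)).card = 15) ∧
      (∀ j₁ j₂ : idx, j₁ ≠ j₂ →
        (Finset.univ.filter (fun i => N i j₁ = 1 ∧ N i j₂ = 1)).card = 6) ∧
      -- the design has trivial full automorphism group
      (∀ σ : Equiv.Perm idx, (∀ i, ∃ i', ∀ j, N i (σ j) = N i' j) → σ = 1) ∧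
      -- C' is self-dual
      (∀ v : idx → ZMod 3, v ∈ C' ↔ ∀ c ∈ C', ∑ j, v j * c j = 0) ∧
      -- C' has dimension 18
      Module.finrank (ZMod 3) C' = 18 ∧
      -- C' has minimum weight 12
      (∀ c ∈ C', c ≠ 0 → 12 ≤ (Finset.univ.filter (fun j => c j ≠ 0)).card) ∧
      (∃ c ∈ C', c ≠ 0 ∧ (Finset.univ.filter (fun j => c j ≠ 0)).card = 12) ∧
      -- C' is monomially equivalent to the Pless symmetry code C(17)
      (∃ M : Matrix idx idx (ZMod 3), IsMonomial3 M ∧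
        (fun c => Matrix.vecMul c M) '' (Ccode (ZMod 17) : Set (idx → ZMod 3)) =
          (C' : Set (idx → ZMod 3))) := by
  have hrange : Submodule.span (ZMod 3) (Set.range fun i j => ((incidence i j : ℤ) : ZMod 3)) =
      graphCode signedPlessMatrix := span_incidence₃
  refine ⟨incidence, graphCode signedPlessMatrix, hrange.symm, fun i j => ?_, card_row,
    fun _ _ => card_pair, fun σ => eq_one_of_cubeDegree₂_injective incidence_injective
      cubeDegree₂_incidence_injective,
    fun v => mem_graphCode_iff_forall_dotProduct signedPlessMatrix_mul_transpose, ?_, ?_, ?_,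
    signMatrix, isMonomial3_signMatrix, vecMul_signMatrix_image⟩
  · simp only [incidence]
    split_ifs <;> simp
  · simp [finrank_graphCode]
  · rintro _ ⟨x, rfl⟩ hx
    have := twelve_le_hammingNorm_add (x := x) fun h => hx (by rw [h, map_zero])
    rwa [← hammingNorm_vecMul_signedPlessMatrix, ← hammingNorm_graphEncode] at this
  · obtain ⟨x, -, hx12⟩ := exists_hammingNorm_eq_twelve
    refine ⟨_, ⟨x, rfl⟩, fun h => ?_, hx12⟩
    simp [h] at hx12
end
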